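/- In the Guerra interpolation for the SK model, with H_{N,t}(σ,α) = √t H_N(σ) + √(1−t) ∑_i z_i(α)σ_i + √t ∑_i y_i(α) and φ(t) = (1/N) E log ∑_{σ,α} v_α exp(β H_{N,t}(σ,α)), the derivative satisfies φ'(t) = −(β²/2) E⟨(R_{1,2} − q_{α¹∧α²})²⟩_t ≤ 0, and hence φ(1) ≤ φ(0). -/

import Mathlib

open MeasureTheory ProbabilityTheory

/-- Spin configurations `{-1,1}^N`. -/
abbrev SpinConf (N : ℕ) := Fin N → ({-1, 1} : Finset ℤ)

/-- The overlap `R_{1,2} = (1/N) ∑_i σ_i¹ σ_i²`. -/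
noncomputable def skR (N : ℕ) (σ1 σ2 : SpinConf N) : ℝ :=
  (1 / N) * ∑ i : Fin N, ((σ1 i : ℤ) : ℝ) * ((σ2 i : ℤ) : ℝ)

/-- The number `α∧β` of common vertices of the paths from the root to the leaves
`α, β ∈ ℕ^r` of the cascade tree. -/
noncomputable def wedge (r : ℕ) (α β : Fin r → ℕ) : ℕ :=
  ((Finset.Icc 1 r).filter fun k => (List.ofFn α).take k = (List.ofFn β).take k).card

/-- The Guerra interpolating Hamiltonian
`H_{N,t}(σ,α) = √t H_N(σ) + √(1−t) ∑_i z_i(α) σ_i + √t ∑_i y_i(α)`. -/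
noncomputable def guerraH {Ω : Type} (N r : ℕ)
    (HN : SpinConf N → Ω → ℝ) (z y : Fin N → (Fin r → ℕ) → Ω → ℝ)
    (t : ℝ) (σ : SpinConf N) (α : Fin r → ℕ) (ω : Ω) : ℝ :=
  Real.sqrt t * HN σ ω + Real.sqrt (1 - t) * ∑ i, z i α ω * ((σ i : ℤ) : ℝ) +
    Real.sqrt t * ∑ i, y i α ω

/-- The partition function `∑_{σ,α} v_α exp(β H_{N,t}(σ,α))`. -/
noncomputable def guerraZ {Ω Ω' : Type} (N r : ℕ)
    (HN : SpinConf N → Ω → ℝ) (z y : Fin N → (Fin r → ℕ) → Ω → ℝ)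
    (v : Ω' → (Fin r → ℕ) → ℝ) (β t : ℝ) (ω' : Ω') (ω : Ω) : ℝ :=
  ∑' α : Fin r → ℕ, ∑ σ : SpinConf N, v ω' α * Real.exp (β * guerraH N r HN z y t σ α ω)

/-- The interpolating free energy `φ(t) = (1/N) E log ∑_{σ,α} v_α exp(β H_{N,t}(σ,α))`. -/
noncomputable def guerraPhi {Ω Ω' : Type} [MeasurableSpace Ω] [MeasurableSpace Ω']
    (ℙg : Measure Ω) (ℙv : Measure Ω') (N r : ℕ)
    (HN : SpinConf N → Ω → ℝ) (z y : Fin N → (Fin r → ℕ) → Ω → ℝ)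
    (v : Ω' → (Fin r → ℕ) → ℝ) (β : ℝ) (t : ℝ) : ℝ :=
  (1 / N) * ∫ ω', ∫ ω, Real.log (guerraZ N r HN z y v β t ω' ω) ∂ℙg ∂ℙv

/-- The annealed Gibbs average `E⟨(R_{1,2} − q_{α¹∧α²})²⟩_t` for the interpolating
Gibbs weights `Γ_t(σ,α) ∝ v_α exp(β H_{N,t}(σ,α))`. -/
noncomputable def guerraGibbsAvg {Ω Ω' : Type} [MeasurableSpace Ω] [MeasurableSpace Ω']
    (ℙg : Measure Ω) (ℙv : Measure Ω') (N r : ℕ) (q : ℕ → ℝ)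
    (HN : SpinConf N → Ω → ℝ) (z y : Fin N → (Fin r → ℕ) → Ω → ℝ)
    (v : Ω' → (Fin r → ℕ) → ℝ) (β : ℝ) (t : ℝ) : ℝ :=
  ∫ ω', ∫ ω,
    ∑' α1 : Fin r → ℕ, ∑' α2 : Fin r → ℕ, ∑ σ1 : SpinConf N, ∑ σ2 : SpinConf N,
      (skR N σ1 σ2 - q (wedge r α1 α2)) ^ 2 *
        (v ω' α1 * Real.exp (β * guerraH N r HN z y t σ1 α1 ω) /
          guerraZ N r HN z y v β t ω' ω) *
        (v ω' α2 * Real.exp (β * guerraH N r HN z y t σ2 α2 ω) /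
          guerraZ N r HN z y v β t ω' ω) ∂ℙg ∂ℙv


theorem gi_stein (v : NNReal) (hv : v ≠ 0) (f f' : ℝ → ℝ) (B B' : ℝ)
    (hf : ∀ x, HasDerivAt f (f' x) x) (hB : ∀ x, |f x| ≤ B) (hB' : ∀ x, |f' x| ≤ B') :
    ∫ x, x * f x ∂(gaussianReal 0 v) = v * ∫ x, f' x ∂(gaussianReal 0 v) := by
  have hvR : (v : ℝ) ≠ 0 := by exact_mod_cast hv
  have hd : f' = deriv f := by ext x; exact (hf x).deriv.symm
  have hfm : Continuous f := continuous_iff_continuousAt.2 fun x => (hf x).continuousAt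
  have hfm' : Measurable f' := hd ▸ measurable_deriv f
  have hpdf : ∀ x, HasDerivAt (gaussianPDFReal 0 v) (-(x / v) * gaussianPDFReal 0 v x) x := by
    intro x
    rw [gaussianPDFReal_def]
    have h1 : HasDerivAt (fun x : ℝ => -(x - 0) ^ 2 / (2 * v)) (-(x / v)) x := by
      have := (((hasDerivAt_id x).sub_const 0).pow 2).neg.div_const (2 * (v : ℝ))
      refine this.congr_deriv ?_
      simp; field_simp
    refine (h1.exp.const_mul ((√(2 * Real.pi * v))⁻¹)).congr_deriv ?_
    ring
  have hpi := integrable_gaussianPDFReal 0 v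
  have hxpi : Integrable (fun x => x * gaussianPDFReal 0 v x) := by
    have h := (memLp_id_gaussianReal (μ := 0) (v := v) 1).integrable le_rfl
    rw [gaussianReal_of_var_ne_zero 0 hv] at h
    rw [integrable_withDensity_iff (measurable_gaussianPDF 0 v)
      (Filter.Eventually.of_forall fun x => gaussianPDF_lt_top)] at h
    simpa [toReal_gaussianPDF] using h
  have key := integral_mul_deriv_eq_deriv_mul_of_integrable (u := f) (v := gaussianPDFReal 0 v)
    (u' := f') (v' := fun x => -(x / v) * gaussianPDFReal 0 v x) (fun x _ => hf x) (fun x _ => hpdf x)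
    (by
      have : (f * fun x => -(x / v) * gaussianPDFReal 0 v x) =
        fun x => f x * ((-(1 / (v:ℝ))) * (x * gaussianPDFReal 0 v x)) := by
        ext x; simp only [Pi.mul_apply]; ring
      rw [this]
      exact (hxpi.const_mul _).bdd_mul (c := B) hfm.aestronglyMeasurable
        (Filter.Eventually.of_forall hB))
    (hpi.bdd_mul (c := B') hfm'.aestronglyMeasurable (Filter.Eventually.of_forall hB'))
    (hpi.bdd_mul (c := B) hfm.aestronglyMeasurable (Filter.Eventually.of_forall hB))
  rw [integral_gaussianReal_eq_integral_smul hv, integral_gaussianReal_eq_integral_smul hv]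
  have e1 : ∫ x, f x * (-(x / v) * gaussianPDFReal 0 v x) =
      -(1 / (v:ℝ)) * ∫ x, gaussianPDFReal 0 v x • (x * f x) := by
    rw [← integral_const_mul]; congr 1; ext x; simp; ring
  have e2 : ∫ x, f' x * gaussianPDFReal 0 v x = ∫ x, gaussianPDFReal 0 v x • f' x := by
    congr 1; ext x; simp; ring
  rw [e1, e2] at key
  field_simp at key
  linarith

noncomputable def giZ {ι : Type} (u h : ι → ℝ) : ℝ := ∑' j, u j * Real.exp (h j)
noncomputable def giw {ι : Type} (u h : ι → ℝ) (i : ι) : ℝ := u i * Real.exp (h i) / giZ u h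

section
variable {ι : Type} {u h : ι → ℝ}

theorem giZ_nonneg (hu : ∀ i, 0 ≤ u i) : 0 ≤ giZ u h :=
  tsum_nonneg fun i => mul_nonneg (hu i) (Real.exp_pos _).le

theorem giw_nonneg (hu : ∀ i, 0 ≤ u i) (i : ι) : 0 ≤ giw u h i :=
  div_nonneg (mul_nonneg (hu i) (Real.exp_pos _).le) (giZ_nonneg hu)

theorem giZ_pos (hu : ∀ i, 0 ≤ u i) (hs : Summable fun j => u j * Real.exp (h j))
    (hne : ∃ i, 0 < u i) : 0 < giZ u h := by
  obtain ⟨i, hi⟩ := hne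
  exact hs.tsum_pos (fun i => mul_nonneg (hu i) (Real.exp_pos _).le) i
    (mul_pos hi (Real.exp_pos _))

theorem giw_of_not (hs : ¬ Summable fun j => u j * Real.exp (h j)) (i : ι) : giw u h i = 0 := by
  simp [giw, giZ, tsum_eq_zero_of_not_summable hs]

theorem giw_summable : Summable (giw u h) := by
  by_cases hs : Summable fun j => u j * Real.exp (h j)
  · exact hs.div_const _
  · have : giw u h = 0 := funext fun i => giw_of_not hs i
    rw [this]; exact summable_zero

theorem giw_tsum_le : ∑' i, giw u h i ≤ 1 := by
  simp only [giw, tsum_div_const]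
  exact div_self_le_one _

theorem giw_le_one (hu : ∀ i, 0 ≤ u i) (i : ι) : giw u h i ≤ 1 :=
  (giw_summable.le_tsum i fun j _ => giw_nonneg hu j).trans giw_tsum_le

theorem giw_mul_summable (hu : ∀ i, 0 ≤ u i) {c : ι → ℝ} {M : ℝ} (hc : ∀ i, |c i| ≤ M) :
    Summable fun j => c j * giw u h j := by
  refine Summable.of_norm_bounded ((giw_summable (u := u) (h := h)).mul_left M) fun j => ?_
  rw [Real.norm_eq_abs, abs_mul, abs_of_nonneg (giw_nonneg hu j)]
  exact mul_le_mul_of_nonneg_right (hc j) (giw_nonneg hu j)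

theorem giw_mul_tsum_le (hu : ∀ i, 0 ≤ u i) {c : ι → ℝ} {M : ℝ} (hM : 0 ≤ M) (hc : ∀ i, |c i| ≤ M) :
    |∑' j, c j * giw u h j| ≤ M := by
  have h1 : ‖∑' j, c j * giw u h j‖ ≤ ∑' j, M * giw u h j :=
    tsum_of_norm_bounded (giw_summable.mul_left M).hasSum fun j => by
      rw [Real.norm_eq_abs, abs_mul, abs_of_nonneg (giw_nonneg hu j)]
      exact mul_le_mul_of_nonneg_right (hc j) (giw_nonneg hu j)
  rw [tsum_mul_left] at h1
  exact h1.trans (mul_le_of_le_one_right hM giw_tsum_le)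

end

theorem gi_measurable_tsum {ι Ω : Type} [Countable ι] [MeasurableSpace Ω] (F : ι → Ω → ℝ)
    (hF : ∀ i, Measurable (F i)) (h0 : ∀ i ω, 0 ≤ F i ω) : Measurable fun ω => ∑' i, F i ω := by
  have : (fun ω => ∑' i, F i ω) = fun ω => (∑' i, ENNReal.ofReal (F i ω)).toReal := by
    ext ω
    rw [ENNReal.tsum_toReal_eq (fun i => ENNReal.ofReal_ne_top)]
    exact tsum_congr fun i => (ENNReal.toReal_ofReal (h0 i ω)).symm
  rw [this]
  exact (Measurable.tsum fun i => (hF i).ennreal_ofReal).ennreal_toReal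

theorem giw_measurable {ι Ω : Type} [Countable ι] [MeasurableSpace Ω] (u : ι → ℝ) (H : ι → Ω → ℝ)
    (hu : ∀ i, 0 ≤ u i) (hH : ∀ i, Measurable (H i)) (i : ι) :
    Measurable fun ω => giw u (fun j => H j ω) i := by
  unfold giw giZ
  refine Measurable.div (by have := hH i; fun_prop) (gi_measurable_tsum _ (fun j => ?_) fun j ω => ?_)
  · have := hH j; fun_prop
  · exact mul_nonneg (hu j) (Real.exp_pos _).le

/-- one-parameter derivative of a Gibbs weight -/
theorem giw_hasDerivAt {ι : Type} (u g a : ι → ℝ) (M : ℝ) (hu : ∀ i, 0 ≤ u i)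
    (hne : ∃ i, 0 < u i) (ha : ∀ i, |a i| ≤ M) (i : ι) (hai : a i = 0) (x : ℝ) :
    HasDerivAt (fun x => giw u (fun j => g j + a j * x) i)
      (-((∑' j, a j * giw u (fun j => g j + a j * x) j) * giw u (fun j => g j + a j * x) i)) x := by
  have hM : 0 ≤ M := (abs_nonneg _).trans (ha i)
  have hsx : ∀ x y : ℝ, Summable (fun j => u j * Real.exp (g j + a j * x)) →
      Summable (fun j => u j * Real.exp (g j + a j * y)) := by
    intro x y hs
    refine Summable.of_nonneg_of_le (fun j => mul_nonneg (hu j) (Real.exp_pos _).le) (fun j => ?_)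
      (hs.mul_right (Real.exp (M * |y - x|)))
    rw [mul_assoc, ← Real.exp_add]
    refine mul_le_mul_of_nonneg_left (Real.exp_le_exp.2 ?_) (hu j)
    have : a j * (y - x) ≤ M * |y - x| := (le_abs_self _).trans (by
      rw [abs_mul]; exact mul_le_mul_of_nonneg_right (ha j) (abs_nonneg _))
    linarith
  by_cases hs : Summable (fun j => u j * Real.exp (g j + a j * x))
  · have hZ : HasDerivAt (fun x => giZ u (fun j => g j + a j * x))
        (∑' j, u j * (Real.exp (g j + a j * x) * a j)) x := by
      unfold giZ
      refine hasDerivAt_tsum_of_isPreconnected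
        (u := fun j => u j * Real.exp (g j + a j * x) * (Real.exp M * M))
        (g := fun j x => u j * Real.exp (g j + a j * x))
        (g' := fun j x => u j * (Real.exp (g j + a j * x) * a j)) (hs.mul_right _)
        (Metric.isOpen_ball (x := x) (ε := 1)) (convex_ball x 1).isPreconnected ?_ ?_
        (Metric.mem_ball_self one_pos) hs (Metric.mem_ball_self one_pos)
      · intro j y _
        have := ((((hasDerivAt_id y).const_mul (a j)).const_add (g j)).exp).const_mul (u j)
        simpa using this
      · intro j y hy
        rw [Metric.mem_ball, Real.dist_eq] at hy
        rw [Real.norm_eq_abs, abs_mul, abs_mul, abs_of_nonneg (hu j), Real.abs_exp, mul_assoc]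
        refine mul_le_mul_of_nonneg_left ?_ (hu j)
        rw [← mul_assoc, ← Real.exp_add]
        refine mul_le_mul (Real.exp_le_exp.2 ?_) (ha j) (abs_nonneg _) (Real.exp_pos _).le
        have : a j * (y - x) ≤ M * 1 := (le_abs_self _).trans (by
          rw [abs_mul]; exact mul_le_mul (ha j) hy.le (abs_nonneg _) hM)
        linarith
    have hZp := giZ_pos hu hs hne
    have h2 := (hasDerivAt_const x (u i * Real.exp (g i))).div hZ hZp.ne'
    unfold giw
    simp only [hai, zero_mul, add_zero]
    refine h2.congr_deriv ?_
    have : ∀ j, a j * (u j * Real.exp (g j + a j * x) / giZ u (fun j => g j + a j * x)) =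
        (u j * (Real.exp (g j + a j * x) * a j)) / giZ u (fun j => g j + a j * x) := by
      intro j; ring
    rw [tsum_congr this, tsum_div_const]
    field_simp
    ring
  · have : (fun x => giw u (fun j => g j + a j * x) i) = fun _ => 0 := by
      ext y; exact giw_of_not (fun h => hs (hsx _ _ h)) i
    rw [this, giw_of_not hs i]
    simpa using hasDerivAt_const x (0:ℝ)


theorem gi_ibp {ι Ω : Type} [Countable ι] [MeasurableSpace Ω] (μ : Measure Ω)
    [IsProbabilityMeasure μ] (X : Ω → ℝ) (H : ι → Ω → ℝ) (hX : Measurable X)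
    (hH : ∀ j, Measurable (H j))
    (hG : IsGaussianProcess (Sum.elim (fun _ : Unit => X) H) μ) (hX0 : ∫ ω, X ω ∂μ = 0)
    (s : ℝ) (hs : 0 < s) (hXX : ∫ ω, X ω * X ω ∂μ = s) (c : ι → ℝ)
    (hc : ∀ j, ∫ ω, X ω * H j ω ∂μ = c j) (M : ℝ) (hM : ∀ j, |c j| ≤ M) (i : ι) (hci : c i = 0)
    (u : ι → ℝ) (hu : ∀ j, 0 ≤ u j) (hne : ∃ j, 0 < u j) (β : ℝ) :
    ∫ ω, X ω * giw u (fun j => β * H j ω) i ∂μ =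
      -β * ∫ ω, (∑' j, c j * giw u (fun j => β * H j ω) j) * giw u (fun j => β * H j ω) i ∂μ := by
  have hM0 : 0 ≤ M := (abs_nonneg _).trans (hM i)
  have hXg : HasGaussianLaw X μ := hG.hasGaussianLaw_eval (Sum.inl ())
  have hHg : ∀ j, HasGaussianLaw (H j) μ := fun j => hG.hasGaussianLaw_eval (Sum.inr j)
  have hXint := hXg.integrable
  set a : ι → ℝ := fun j => c j / s with ha
  set G : ι → Ω → ℝ := fun j ω => H j ω - a j * X ω with hGdef
  have hGm : ∀ j, Measurable (G j) := fun j => (hH j).sub (hX.const_mul _)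
  have hGP : IsGaussianProcess (Sum.elim (fun _ : Unit => X) G) μ := by
    classical
    refine hG.of_isGaussianProcess ?_
    rintro (_ | j)
    · exact ⟨{Sum.inl ()}, ContinuousLinearMap.proj ⟨Sum.inl (), by simp⟩, fun ω => by simp⟩
    · refine ⟨{Sum.inl (), Sum.inr j}, ContinuousLinearMap.proj ⟨Sum.inr j, by simp⟩
        - a j • ContinuousLinearMap.proj ⟨Sum.inl (), by simp⟩, fun ω => by simp [hGdef]⟩
  have hGg : ∀ j, HasGaussianLaw (G j) μ := fun j => hGP.hasGaussianLaw_eval (Sum.inr j)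
  have hind0 : IndepFun (fun ω (_ : Unit) => X ω) (fun ω j => G j ω) μ := by
    refine hGP.indepFun_of_covariance_eq_zero (fun _ => hX.aemeasurable)
      (fun j => (hGm j).aemeasurable) ?_
    intro _ j
    rw [covariance_eq_sub hXg.memLp_two (hGg j).memLp_two, hX0, zero_mul, sub_zero]
    have e : (X * G j) = fun ω => X ω * H j ω - a j * (X ω * X ω) := by
      ext ω; simp only [Pi.mul_apply, hGdef]; ring
    have j1 : Integrable (fun ω => X ω * H j ω) μ :=
      hXg.memLp_two.integrable_mul (hHg j).memLp_two
    have j2 : Integrable (fun ω => X ω * X ω) μ := hXg.memLp_two.integrable_mul hXg.memLp_two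
    rw [e, integral_sub j1 (j2.const_mul _), integral_const_mul, hc, hXX]
    simp only [ha]; field_simp; ring
  have hind : IndepFun X (fun ω j => G j ω) μ :=
    hind0.comp (φ := fun f : Unit → ℝ => f ()) (ψ := id) (measurable_pi_apply ()) measurable_id
  have hGpm : Measurable (fun ω j => G j ω) := measurable_pi_lambda _ hGm
  set ν := μ.map (fun ω j => G j ω) with hν
  have : IsProbabilityMeasure ν := Measure.isProbabilityMeasure_map hGpm.aemeasurable
  set sv : NNReal := ⟨s, hs.le⟩ with hsv
  have hsv0 : sv ≠ 0 := fun h => hs.ne' (congrArg NNReal.toReal h)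
  have hmapX : μ.map X = gaussianReal 0 sv := by
    rw [hXg.map_eq_gaussianReal, hX0]
    congr 1
    rw [variance_eq_integral hX.aemeasurable, hX0]
    ext
    simp only [sub_zero, pow_two, hXX, hsv]
    exact Real.coe_toNNReal _ hs.le
  have hprod : μ.map (fun ω => (X ω, fun j => G j ω)) = (gaussianReal 0 sv).prod ν := by
    rw [← hmapX]
    exact (indepFun_iff_map_prod_eq_prod_map_map hX.aemeasurable hGpm.aemeasurable).1 hind
  set Hf : ι → (ℝ × (ι → ℝ)) → ℝ := fun j p => β * p.2 j + β * a j * p.1 with hHf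
  have hHfm : ∀ j, Measurable (Hf j) := fun j => by
    have : Measurable fun p : ℝ × (ι → ℝ) => p.2 j := (measurable_pi_apply j).comp measurable_snd
    exact (this.const_mul _).add (measurable_fst.const_mul _)
  set f : ℝ × (ι → ℝ) → ι → ℝ := fun p k => giw u (fun j => Hf j p) k with hf
  have hfm : ∀ k, Measurable fun p => f p k := fun k => giw_measurable u Hf hu hHfm k
  set S : ℝ × (ι → ℝ) → ℝ := fun p => ∑' j, c j * f p j with hS
  have hSm : Measurable S := Measurable.tsum fun j => (hfm j).const_mul _
  have hfb : ∀ p k, |f p k| ≤ 1 := fun p k => by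
    rw [abs_of_nonneg (giw_nonneg hu k)]; exact giw_le_one hu k
  have hSb : ∀ p, |S p| ≤ M := fun p => giw_mul_tsum_le hu hM0 hM
  have hcomp : ∀ ω, (fun j => β * H j ω) = fun j => Hf j (X ω, fun j => G j ω) := by
    intro ω; ext j; simp only [hHf, hGdef]; ring
  have hpm : Measurable fun ω => (X ω, fun j => G j ω) := hX.prodMk hGpm
  have e1 : ∫ ω, X ω * giw u (fun j => β * H j ω) i ∂μ =
      ∫ p, p.1 * f p i ∂((gaussianReal 0 sv).prod ν) := by
    have hm : Measurable fun p : ℝ × (ι → ℝ) => p.1 * f p i := measurable_fst.mul (hfm i)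
    rw [← hprod, integral_map hpm.aemeasurable hm.aestronglyMeasurable]
    simp only [hcomp, hf]
  have e2 : ∫ ω, (∑' j, c j * giw u (fun j => β * H j ω) j) * giw u (fun j => β * H j ω) i ∂μ =
      ∫ p, S p * f p i ∂((gaussianReal 0 sv).prod ν) := by
    have hm : Measurable fun p : ℝ × (ι → ℝ) => S p * f p i := hSm.mul (hfm i)
    rw [← hprod, integral_map hpm.aemeasurable hm.aestronglyMeasurable]
    simp only [hcomp, hf, hS]
  have hid : Integrable (fun x : ℝ => x) (gaussianReal 0 sv) :=
    (memLp_id_gaussianReal (μ := 0) (v := sv) 1).integrable le_rfl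
  have i1 : Integrable (fun p : ℝ × (ι → ℝ) => p.1 * f p i) ((gaussianReal 0 sv).prod ν) := by
    exact (hid.comp_fst ν).mul_bdd (c := 1) (hfm i).aestronglyMeasurable
      (Filter.Eventually.of_forall fun p => hfb p i)
  have i2 : Integrable (fun p : ℝ × (ι → ℝ) => S p * f p i) ((gaussianReal 0 sv).prod ν) := by
    refine Integrable.of_bound (hSm.mul (hfm i)).aestronglyMeasurable (M * 1)
      (Filter.Eventually.of_forall fun p => ?_)
    rw [Real.norm_eq_abs, abs_mul]
    exact mul_le_mul (hSb p) (hfb p i) (abs_nonneg _) hM0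
  rw [e1, e2, integral_prod_symm _ i1, integral_prod_symm _ i2, ← integral_const_mul]
  congr 1
  ext g
  have hder : ∀ x, HasDerivAt (fun x => f (x, g) i) (-β / s * (S (x, g) * f (x, g) i)) x := by
    intro x
    have := giw_hasDerivAt u (fun j => β * g j) (fun j => β * a j) (|β| * (M / s)) hu hne
      (fun j => by
        rw [abs_mul, ha, abs_div, abs_of_pos hs]
        have := hM j
        gcongr) i (by simp [ha, hci]) x
    refine this.congr_deriv ?_
    have e : ∀ j, β * a j * giw u (fun j => β * g j + β * a j * x) j =
      β / s * (c j * f (x, g) j) := by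
      intro j; simp only [ha, hf, hHf]; ring
    rw [tsum_congr e, tsum_mul_left]
    simp only [hS, hf, hHf]
    ring
  have := gi_stein sv hsv0 (fun x => f (x, g) i) _ 1 (|-β / s| * (M * 1)) hder
    (fun x => hfb _ _) (fun x => by
      rw [abs_mul, abs_mul]
      exact mul_le_mul_of_nonneg_left (mul_le_mul (hSb _) (hfb _ _) (abs_nonneg _) hM0)
        (abs_nonneg _))
  rw [this, integral_const_mul]
  have : (sv : ℝ) = s := rfl
  rw [this]; field_simp


section
variable {ι : Type} {u h A : ι → ℝ} {S : ℝ}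

theorem gi_summable_of_le (hu : ∀ i, 0 ≤ u i) (hA : ∀ i, h i ≤ A i)
    (hs : Summable fun j => u j * Real.exp (A j)) : Summable fun j => u j * Real.exp (h j) :=
  Summable.of_nonneg_of_le (fun j => mul_nonneg (hu j) (Real.exp_pos _).le)
    (fun j => mul_le_mul_of_nonneg_left (Real.exp_le_exp.2 (hA j)) (hu j)) hs

theorem giZ_le (hu : ∀ i, 0 ≤ u i) (hA : ∀ i, h i ≤ A i)
    (hs : Summable fun j => u j * Real.exp (A j)) : giZ u h ≤ giZ u A :=
  (gi_summable_of_le hu hA hs).tsum_le_tsum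
    (fun j => mul_le_mul_of_nonneg_left (Real.exp_le_exp.2 (hA j)) (hu j)) hs

theorem gi_exists_pos (hu : ∀ i, 0 ≤ u i) (hS : HasSum u S) (hSp : 0 < S) : ∃ i, 0 < u i := by
  by_contra! hc
  have : u = 0 := funext fun i => le_antisymm (hc i) (hu i)
  rw [this] at hS
  exact hSp.ne' (hS.unique hasSum_zero)

theorem giZ_inv_le (hu : ∀ i, 0 ≤ u i) (hS : HasSum u S) (hSp : 0 < S) (hA : ∀ i, |h i| ≤ A i)
    (hs : Summable fun j => u j * Real.exp (A j)) : (giZ u h)⁻¹ ≤ (S ^ 2)⁻¹ * giZ u A := by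
  have h1 := gi_summable_of_le hu (fun i => (le_abs_self _).trans (hA i)) hs
  have h2 : Summable fun j => u j * Real.exp (-h j) :=
    gi_summable_of_le (h := fun j => -h j) hu (fun i => (neg_le_abs _).trans (hA i)) hs
  have h3 : giZ u (fun j => -h j) ≤ giZ u A :=
    giZ_le hu (fun i => (neg_le_abs _).trans (hA i)) hs
  have hZ := giZ_pos hu h1 (gi_exists_pos hu hS hSp)
  set Z := giZ u h with hZd
  have key : S * (2 * (S / Z)) ≤ Z * (S / Z) ^ 2 + giZ u (fun j => -h j) := by
    refine hasSum_le (fun j => ?_) (hS.mul_right (2 * (S / Z)))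
      ((h1.hasSum.mul_right ((S / Z) ^ 2)).add h2.hasSum)
    rw [mul_assoc, ← mul_add]
    refine mul_le_mul_of_nonneg_left ?_ (hu j)
    have e : Real.exp (h j) * Real.exp (-h j) = 1 := by rw [← Real.exp_add]; simp
    have p := Real.exp_pos (-h j)
    nlinarith [mul_nonneg (Real.exp_pos (h j)).le (sq_nonneg (S / Z - Real.exp (-h j)))]
  have : S ^ 2 * Z⁻¹ ≤ giZ u A := by
    have e : S * (2 * (S / Z)) - Z * (S / Z) ^ 2 = S ^ 2 * Z⁻¹ := by field_simp; ring
    linarith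
  rw [← div_eq_inv_mul, le_div_iff₀ (by positivity)]
  linarith

theorem gi_log_le (hu : ∀ i, 0 ≤ u i) (hS : HasSum u S) (hSp : 0 < S) (hA : ∀ i, |h i| ≤ A i)
    (hs : Summable fun j => u j * Real.exp (A j)) :
    |Real.log (giZ u h)| ≤ (1 + (S ^ 2)⁻¹) * giZ u A := by
  have h1 := gi_summable_of_le hu (fun i => (le_abs_self _).trans (hA i)) hs
  have hZ := giZ_pos hu h1 (gi_exists_pos hu hS hSp)
  have hle := giZ_le hu (fun i => (le_abs_self _).trans (hA i)) hs
  have hinv := giZ_inv_le hu hS hSp hA hs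
  have l1 := Real.log_le_sub_one_of_pos hZ
  have l2 := Real.log_le_sub_one_of_pos (inv_pos.2 hZ)
  rw [Real.log_inv] at l2
  have hA0 : 0 ≤ giZ u A := giZ_nonneg hu
  have : 0 ≤ (S ^ 2)⁻¹ * giZ u A := by positivity
  rw [abs_le]
  constructor <;> nlinarith

/-- `W_b ^ 2 ≤ S W_{2b}` -/
theorem giZ_sq_le (hu : ∀ i, 0 ≤ u i) (hS : HasSum u S) (hSp : 0 < S) 
    (hs1 : Summable fun j => u j * Real.exp (A j))
    (hs : Summable fun j => u j * Real.exp (2 * A j)) :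
    giZ u A ^ 2 ≤ S * giZ u (fun j => 2 * A j) := by
  set W := giZ u A with hW
  have key : W * (2 * (W / S)) ≤ S * (W / S) ^ 2 + giZ u (fun j => 2 * A j) := by
    refine hasSum_le (fun j => ?_) (hs1.hasSum.mul_right (2 * (W / S)))
      ((hS.mul_right ((W / S) ^ 2)).add hs.hasSum)
    rw [mul_assoc, ← mul_add]
    refine mul_le_mul_of_nonneg_left ?_ (hu j)
    have e : Real.exp (2 * A j) = Real.exp (A j) ^ 2 := by rw [two_mul, Real.exp_add, sq]
    rw [e]
    nlinarith [sq_nonneg (W / S - Real.exp (A j))]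
  have e : W * (2 * (W / S)) - S * (W / S) ^ 2 = W ^ 2 / S := by field_simp; ring
  have : W ^ 2 / S ≤ giZ u (fun j => 2 * A j) := by linarith
  rw [div_le_iff₀ hSp] at this
  linarith

end

theorem gi_sum_int {ι Ω : Type} [Countable ι] [MeasurableSpace Ω] (μ : Measure Ω)
    (F : ι → Ω → ℝ) (u : ι → ℝ) (S K : ℝ) (hK : 0 ≤ K) (hu : ∀ i, 0 ≤ u i) (hS : HasSum u S)
    (hF : ∀ i, Measurable (F i)) (h0 : ∀ i ω, 0 ≤ F i ω) (hI : ∀ i, Integrable (F i) μ)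
    (hb : ∀ i, ∫ ω, F i ω ∂μ ≤ K) :
    (∀ᵐ ω ∂μ, Summable fun i => u i * F i ω) ∧ Integrable (fun ω => ∑' i, u i * F i ω) μ ∧
      ∫ ω, ∑' i, u i * F i ω ∂μ ≤ S * K := by
  have hn : ∀ i ω, 0 ≤ u i * F i ω := fun i ω => mul_nonneg (hu i) (h0 i ω)
  have hsm : Summable fun i => ∫ ω, ‖u i * F i ω‖ ∂μ := by
    refine Summable.of_nonneg_of_le (fun i => integral_nonneg fun ω => norm_nonneg _) (fun i => ?_)
      (hS.summable.mul_right K)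
    simp only [Real.norm_of_nonneg (hn _ _)]
    rw [integral_const_mul]
    exact mul_le_mul_of_nonneg_left (hb i) (hu i)
  have hL : ∫⁻ ω, ∑' i, ENNReal.ofReal (u i * F i ω) ∂μ ≠ ⊤ := by
    rw [lintegral_tsum fun i => ((hF i).const_mul _).ennreal_ofReal.aemeasurable]
    have : ∀ i, ∫⁻ ω, ENNReal.ofReal (u i * F i ω) ∂μ =
        ENNReal.ofReal (∫ ω, ‖u i * F i ω‖ ∂μ) := by
      intro i
      simp only [Real.norm_of_nonneg (hn _ _)]
      rw [ofReal_integral_eq_lintegral_ofReal ((hI i).const_mul _)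
        (Filter.Eventually.of_forall fun ω => hn i ω)]
    simp only [this]
    exact hsm.tsum_ofReal_ne_top
  have hm : Measurable fun ω => ∑' i, ENNReal.ofReal (u i * F i ω) :=
    Measurable.tsum fun i => ((hF i).const_mul _).ennreal_ofReal
  refine ⟨?_, ?_, ?_⟩
  · filter_upwards [ae_lt_top hm hL] with ω hω
    have := ENNReal.summable_toReal hω.ne
    refine this.congr fun i => (ENNReal.toReal_ofReal (hn i ω))
  · have := integrable_toReal_of_lintegral_ne_top hm.aemeasurable hL
    refine this.congr (Filter.Eventually.of_forall fun ω => ?_)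
    simp only
    rw [ENNReal.tsum_toReal_eq (fun i => ENNReal.ofReal_ne_top)]
    exact tsum_congr fun i => (ENNReal.toReal_ofReal (hn i ω))
  · have := hasSum_integral_of_summable_integral_norm (fun i => (hI i).const_mul (u i)) hsm
    refine hasSum_le (fun i => ?_) this (hS.mul_right K)
    rw [integral_const_mul]
    exact mul_le_mul_of_nonneg_left (hb i) (hu i)

theorem gi_expmom {Ω : Type} [MeasurableSpace Ω] (μ : Measure Ω) [IsProbabilityMeasure μ]
    (X : Ω → ℝ) (hXm : Measurable X) (hX : HasGaussianLaw X μ) (h0 : ∫ ω, X ω ∂μ = 0) (V : ℝ)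
    (hV : ∫ ω, X ω * X ω ∂μ = V) (c : ℝ) :
    Integrable (fun ω => Real.exp (c * |X ω|)) μ ∧
      ∫ ω, Real.exp (c * |X ω|) ∂μ ≤ 2 * Real.exp (V * c ^ 2 / 2) := by
  have hV0 : 0 ≤ V := hV ▸ integral_nonneg fun ω => mul_self_nonneg _
  have hmap : μ.map X = gaussianReal 0 V.toNNReal := by
    rw [hX.map_eq_gaussianReal, h0, variance_eq_integral hXm.aemeasurable, h0]
    simp only [sub_zero, pow_two, hV]
  have hI : ∀ c : ℝ, Integrable (fun ω => Real.exp (c * X ω)) μ := by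
    intro c
    have := integrable_exp_mul_gaussianReal (μ := 0) (v := V.toNNReal) c
    rw [← hmap] at this
    exact this.comp_measurable hXm
  have hval : ∀ c : ℝ, ∫ ω, Real.exp (c * X ω) ∂μ = Real.exp (V * c ^ 2 / 2) := by
    intro c
    have := mgf_gaussianReal hmap c
    rw [mgf] at this
    rw [this, Real.coe_toNNReal _ hV0]; simp
  have hle : ∀ ω, Real.exp (c * |X ω|) ≤ Real.exp (c * X ω) + Real.exp (-c * X ω) := by
    intro ω
    rcases abs_cases (X ω) with ⟨h, _⟩ | ⟨h, _⟩ <;> rw [h]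
    · linarith [Real.exp_pos (-c * X ω)]
    · rw [mul_neg, ← neg_mul]; linarith [Real.exp_pos (c * X ω)]
  have hint : Integrable (fun ω => Real.exp (c * |X ω|)) μ := by
    refine ((hI c).add (hI (-c))).mono' (by fun_prop) (Filter.Eventually.of_forall fun ω => ?_)
    rw [Real.norm_of_nonneg (Real.exp_pos _).le]; exact hle ω
  refine ⟨hint, ?_⟩
  have := integral_mono hint ((hI c).add (hI (-c))) hle
  rw [integral_add' (hI c) (hI (-c)), hval, hval] at this
  rw [neg_sq] at this; linarith

theorem gi_expmom2 {Ω : Type} [MeasurableSpace Ω] (μ : Measure Ω) [IsProbabilityMeasure μ]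
    (X Y : Ω → ℝ) (hXm : Measurable X) (hYm : Measurable Y) (hX : HasGaussianLaw X μ)
    (hY : HasGaussianLaw Y μ) (h0 : ∫ ω, X ω ∂μ = 0) (h0' : ∫ ω, Y ω ∂μ = 0) (V : ℝ)
    (hV : ∫ ω, X ω * X ω ∂μ = V) (hV' : ∫ ω, Y ω * Y ω ∂μ = V) (c : ℝ) (hc : 0 ≤ c) :
    Integrable (fun ω => Real.exp (c * (|X ω| + |Y ω|))) μ ∧
      ∫ ω, Real.exp (c * (|X ω| + |Y ω|)) ∂μ ≤ 4 * Real.exp (V * (2 * c) ^ 2 / 2) := by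
  obtain ⟨i1, b1⟩ := gi_expmom μ X hXm hX h0 V hV (2 * c)
  obtain ⟨i2, b2⟩ := gi_expmom μ Y hYm hY h0' V hV' (2 * c)
  have hle : ∀ ω, Real.exp (c * (|X ω| + |Y ω|)) ≤
      Real.exp (2 * c * |X ω|) + Real.exp (2 * c * |Y ω|) := by
    intro ω
    rcases le_total |X ω| |Y ω| with h | h
    · have : Real.exp (c * (|X ω| + |Y ω|)) ≤ Real.exp (2 * c * |Y ω|) :=
        Real.exp_le_exp.2 (by nlinarith)
      linarith [Real.exp_pos (2 * c * |X ω|)]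
    · have : Real.exp (c * (|X ω| + |Y ω|)) ≤ Real.exp (2 * c * |X ω|) :=
        Real.exp_le_exp.2 (by nlinarith)
      linarith [Real.exp_pos (2 * c * |Y ω|)]
  have hint : Integrable (fun ω => Real.exp (c * (|X ω| + |Y ω|))) μ := by
    refine (i1.add i2).mono' (by fun_prop) (Filter.Eventually.of_forall fun ω => ?_)
    rw [Real.norm_of_nonneg (Real.exp_pos _).le]; exact hle ω
  refine ⟨hint, ?_⟩
  have := integral_mono hint (i1.add i2) hle
  rw [integral_add' i1 i2] at this
  linarith


structure GiSys {ι Ω : Type} [MeasurableSpace Ω] (μ : Measure Ω) (P Q : ι → Ω → ℝ)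
    (p r : ι → ι → ℝ) (K M : ℝ) : Prop where
  mP : ∀ i, Measurable (P i)
  mQ : ∀ i, Measurable (Q i)
  hG : IsGaussianProcess (Sum.elim P Q) μ
  P0 : ∀ i, ∫ ω, P i ω ∂μ = 0
  Q0 : ∀ i, ∫ ω, Q i ω ∂μ = 0
  PP : ∀ i j, ∫ ω, P i ω * P j ω ∂μ = p i j
  QQ : ∀ i j, ∫ ω, Q i ω * Q j ω ∂μ = r i j
  PQ : ∀ i j, ∫ ω, P i ω * Q j ω ∂μ = 0
  pK : ∀ i, p i i = K
  rK : ∀ i, r i i = K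
  Kpos : 0 < K
  CM : ∀ i j, |p i j - r i j| ≤ M

noncomputable def giH {ι Ω : Type} (P Q : ι → Ω → ℝ) (t : ℝ) (i : ι) (ω : Ω) : ℝ :=
  Real.sqrt t * P i ω + Real.sqrt (1 - t) * Q i ω

noncomputable def giPsi {ι Ω : Type} [MeasurableSpace Ω] (μ : Measure Ω) (P Q : ι → Ω → ℝ)
    (β : ℝ) (u : ι → ℝ) (t : ℝ) : ℝ := ∫ ω, Real.log (giZ u fun j => β * giH P Q t j ω) ∂μ

set_option linter.unusedSectionVars false
section
variable {ι Ω : Type} [Countable ι] [MeasurableSpace Ω] {μ : Measure Ω} [IsProbabilityMeasure μ]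
  {P Q : ι → Ω → ℝ} {p r : ι → ι → ℝ} {K M : ℝ} {u : ι → ℝ} {S β : ℝ}

theorem gi_cov (G : GiSys μ P Q p r K M) (a b c d : ℝ) (i j : ι) :
    ∫ ω, (a * P i ω + b * Q i ω) * (c * P j ω + d * Q j ω) ∂μ = a * c * p i j + b * d * r i j := by
  have LP : ∀ i, MemLp (P i) 2 μ := fun i => (G.hG.hasGaussianLaw_eval (Sum.inl i)).memLp_two
  have LQ : ∀ i, MemLp (Q i) 2 μ := fun i => (G.hG.hasGaussianLaw_eval (Sum.inr i)).memLp_two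
  have i1 : Integrable (fun ω => P i ω * P j ω) μ := (LP i).integrable_mul (LP j)
  have i2 : Integrable (fun ω => P i ω * Q j ω) μ := (LP i).integrable_mul (LQ j)
  have i3 : Integrable (fun ω => P j ω * Q i ω) μ := (LP j).integrable_mul (LQ i)
  have i4 : Integrable (fun ω => Q i ω * Q j ω) μ := (LQ i).integrable_mul (LQ j)
  have e : ∀ ω, (a * P i ω + b * Q i ω) * (c * P j ω + d * Q j ω) =
    (a * c * (P i ω * P j ω) + a * d * (P i ω * Q j ω)) +
      (b * c * (P j ω * Q i ω) + b * d * (Q i ω * Q j ω)) := fun ω => by ring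
  simp only [e]
  have j1 : Integrable (fun ω => a * c * (P i ω * P j ω) + a * d * (P i ω * Q j ω)) μ :=
    (i1.const_mul _).add (i2.const_mul _)
  have j2 : Integrable (fun ω => b * c * (P j ω * Q i ω) + b * d * (Q i ω * Q j ω)) μ :=
    (i3.const_mul _).add (i4.const_mul _)
  rw [integral_add j1 j2, integral_add (i1.const_mul _) (i2.const_mul _),
    integral_add (i3.const_mul _) (i4.const_mul _)]
  simp only [integral_const_mul, G.PP, G.PQ, G.QQ]
  ring

theorem gi_gauss (G : GiSys μ P Q p r K M) (a b c d : ℝ) (i : ι) :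
    IsGaussianProcess (Sum.elim (fun _ : Unit => fun ω => a * P i ω + b * Q i ω)
      (fun j ω => c * P j ω + d * Q j ω)) μ := by
  classical
  have hGG := G.hG
  refine hGG.of_isGaussianProcess ?_
  have key : ∀ (a b : ℝ) (i : ι), ∃ I : Finset (ι ⊕ ι), ∃ L : (I → ℝ) →L[ℝ] ℝ, ∀ ω,
      a * P i ω + b * Q i ω = L (I.restrict fun x => Sum.elim P Q x ω) := by
    intro a b i
    exact ⟨{Sum.inl i, Sum.inr i}, a • ContinuousLinearMap.proj ⟨Sum.inl i, by simp⟩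
        + b • ContinuousLinearMap.proj ⟨Sum.inr i, by simp⟩, fun ω => by simp⟩
  rintro (_ | j)
  · exact key a b i
  · exact key c d j

theorem gi_W (G : GiSys μ P Q p r K M) (hu : ∀ i, 0 ≤ u i) (hS : HasSum u S) (c : ℝ) (hc : 0 ≤ c) :
    (∀ᵐ ω ∂μ, Summable fun i => u i * Real.exp (c * (|P i ω| + |Q i ω|))) ∧
    Integrable (fun ω => giZ u fun i => c * (|P i ω| + |Q i ω|)) μ ∧
    ∫ ω, giZ u (fun i => c * (|P i ω| + |Q i ω|)) ∂μ ≤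
      S * (4 * Real.exp (K * (2 * c) ^ 2 / 2)) := by
  have h := fun i => gi_expmom2 μ (P i) (Q i) (G.mP i) (G.mQ i)
    (G.hG.hasGaussianLaw_eval (Sum.inl i)) (G.hG.hasGaussianLaw_eval (Sum.inr i)) (G.P0 i) (G.Q0 i)
    K ((G.PP i i).trans (G.pK i)) ((G.QQ i i).trans (G.rK i)) c hc
  exact gi_sum_int μ (fun i ω => Real.exp (c * (|P i ω| + |Q i ω|))) u S _ (by positivity) hu hS
    (fun i => by have := G.mP i; have := G.mQ i; fun_prop) (fun i ω => (Real.exp_pos _).le)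
    (fun i => (h i).1) (fun i => (h i).2)

theorem giH_le {t : ℝ} (ht : t ∈ Set.Icc (0:ℝ) 1) (i : ι) (ω : Ω) :
    |β * giH P Q t i ω| ≤ |β| * (|P i ω| + |Q i ω|) := by
  rw [abs_mul, giH]
  refine mul_le_mul_of_nonneg_left ((abs_add_le _ _).trans ?_) (abs_nonneg _)
  rw [abs_mul, abs_mul, abs_of_nonneg (Real.sqrt_nonneg _), abs_of_nonneg (Real.sqrt_nonneg _)]
  have h1 : Real.sqrt t ≤ 1 := Real.sqrt_le_one.2 ht.2
  have h2 : Real.sqrt (1 - t) ≤ 1 := Real.sqrt_le_one.2 (by linarith [ht.1])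
  exact add_le_add (mul_le_of_le_one_left (abs_nonneg _) h1)
    (mul_le_of_le_one_left (abs_nonneg _) h2)

theorem giH_meas (G : GiSys μ P Q p r K M) (t : ℝ) (i : ι) : Measurable (giH P Q t i) := by
  have := G.mP i; have := G.mQ i
  unfold giH; fun_prop

theorem gi_logZ_meas (G : GiSys μ P Q p r K M) (t : ℝ) :
    Measurable fun ω => Real.log (giZ u fun j => β * giH P Q t j ω) := by
  refine Real.measurable_log.comp ?_
  unfold giZ
  refine Measurable.tsum fun j => ?_
  have := giH_meas G t j
  fun_prop

theorem gi_logZ_int (G : GiSys μ P Q p r K M) (hu : ∀ i, 0 ≤ u i) (hS : HasSum u S) (hSp : 0 < S)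
    {t : ℝ} (ht : t ∈ Set.Icc (0:ℝ) 1) :
    Integrable (fun ω => Real.log (giZ u fun j => β * giH P Q t j ω)) μ ∧
    |giPsi μ P Q β u t| ≤
      (1 + (S ^ 2)⁻¹) * (S * (4 * Real.exp (K * (2 * |β|) ^ 2 / 2))) := by
  obtain ⟨w1, w2, w3⟩ := gi_W G hu hS |β| (abs_nonneg β)
  have hb : ∀ᵐ ω ∂μ, ‖Real.log (giZ u fun j => β * giH P Q t j ω)‖ ≤
      (1 + (S ^ 2)⁻¹) * giZ u (fun i => |β| * (|P i ω| + |Q i ω|)) := by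
    filter_upwards [w1] with ω hω
    exact gi_log_le hu hS hSp (fun i => giH_le ht i ω) hω
  refine ⟨(w2.const_mul _).mono' (gi_logZ_meas G t).aestronglyMeasurable hb, ?_⟩
  refine (norm_integral_le_of_norm_le (w2.const_mul _) hb).trans ?_
  rw [integral_const_mul]
  exact mul_le_mul_of_nonneg_left w3 (by positivity)

theorem gi_cont (G : GiSys μ P Q p r K M) (hu : ∀ i, 0 ≤ u i) (hS : HasSum u S) (hSp : 0 < S) :
    ContinuousOn (giPsi μ P Q β u) (Set.Icc 0 1) := by
  obtain ⟨w1, w2, w3⟩ := gi_W G hu hS |β| (abs_nonneg β)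
  refine continuousOn_of_dominated
    (bound := fun ω => (1 + (S ^ 2)⁻¹) * giZ u (fun i => |β| * (|P i ω| + |Q i ω|)))
    (fun t _ => (gi_logZ_meas G t).aestronglyMeasurable) (fun t ht => ?_) (w2.const_mul _) ?_
  · filter_upwards [w1] with ω hω
    exact gi_log_le hu hS hSp (fun i => giH_le ht i ω) hω
  · filter_upwards [w1] with ω hω
    refine ContinuousOn.log ?_ fun t ht => ?_
    · unfold giZ
      refine continuousOn_tsum (fun j => ?_) hω fun j t ht => ?_
      · unfold giH; fun_prop
      · rw [Real.norm_of_nonneg (mul_nonneg (hu j) (Real.exp_pos _).le)]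
        exact mul_le_mul_of_nonneg_left
          (Real.exp_le_exp.2 ((le_abs_self _).trans (giH_le ht j ω))) (hu j)
    · exact (giZ_pos hu (gi_summable_of_le hu
        (fun i => (le_abs_self _).trans (giH_le ht i ω)) hω) (gi_exists_pos hu hS hSp)).ne'

end


noncomputable def giD {ι Ω : Type} (P Q : ι → Ω → ℝ) (t : ℝ) (i : ι) (ω : Ω) : ℝ :=
  1 / (2 * Real.sqrt t) * P i ω + (-(1 / (2 * Real.sqrt (1 - t)))) * Q i ω

noncomputable def giKap (t : ℝ) : ℝ := 1 / (2 * Real.sqrt (t / 2)) + 1 / (2 * Real.sqrt ((1 - t) / 2))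

set_option linter.unusedSectionVars false
section
variable {ι Ω : Type} [Countable ι] [MeasurableSpace Ω] {μ : Measure Ω} [IsProbabilityMeasure μ]
  {P Q : ι → Ω → ℝ} {p r : ι → ι → ℝ} {K M : ℝ} {u : ι → ℝ} {S β t t0 : ℝ}

theorem giH_deriv (ht : t ∈ Set.Ioo (0:ℝ) 1) (i : ι) (ω : Ω) :
    HasDerivAt (fun t => giH P Q t i ω) (giD P Q t i ω) t := by
  unfold giH giD
  have h1 : HasDerivAt (fun t => Real.sqrt t) (1 / (2 * Real.sqrt t)) t :=
    Real.hasDerivAt_sqrt ht.1.ne'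
  have h2 : HasDerivAt (fun t => Real.sqrt (1 - t)) (-1 / (2 * Real.sqrt (1 - t))) t :=
    HasDerivAt.sqrt (by simpa using (hasDerivAt_id t).const_sub 1) (by linarith [ht.2])
  refine ((h1.mul_const (P i ω)).add (h2.mul_const (Q i ω))).congr_deriv ?_
  ring

theorem giKap_nonneg (t : ℝ) : 0 ≤ giKap t := by unfold giKap; positivity

theorem gi_nbhd (h0 : t0 ∈ Set.Ioo (0:ℝ) 1) (ht : t ∈ Set.Ioo (t0 / 2) ((t0 + 1) / 2)) :
    t ∈ Set.Ioo (0:ℝ) 1 := ⟨by linarith [h0.1, ht.1], by linarith [h0.2, ht.2]⟩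

theorem giD_le (h0 : t0 ∈ Set.Ioo (0:ℝ) 1) (ht : t ∈ Set.Ioo (t0 / 2) ((t0 + 1) / 2)) (i : ι)
    (ω : Ω) : |giD P Q t i ω| ≤ giKap t0 * (|P i ω| + |Q i ω|) := by
  have p0 := h0.1
  have p1 := h0.2
  have a1 : 1 / (2 * Real.sqrt t) ≤ 1 / (2 * Real.sqrt (t0 / 2)) := by
    have : 0 < Real.sqrt (t0 / 2) := Real.sqrt_pos.2 (by linarith)
    have := Real.sqrt_le_sqrt ht.1.le
    gcongr
  have a2 : 1 / (2 * Real.sqrt (1 - t)) ≤ 1 / (2 * Real.sqrt ((1 - t0) / 2)) := by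
    have : 0 < Real.sqrt ((1 - t0) / 2) := Real.sqrt_pos.2 (by linarith)
    have := Real.sqrt_le_sqrt (show (1 - t0) / 2 ≤ 1 - t by linarith [ht.2])
    gcongr
  have b1 : 0 ≤ 1 / (2 * Real.sqrt t) := by positivity
  have b2 : 0 ≤ 1 / (2 * Real.sqrt (1 - t)) := by positivity
  have c1 : 0 ≤ 1 / (2 * Real.sqrt (t0 / 2)) := by positivity
  have c2 : 0 ≤ 1 / (2 * Real.sqrt ((1 - t0) / 2)) := by positivity
  unfold giD giKap
  refine (abs_add_le _ _).trans ?_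
  rw [abs_mul, abs_mul, abs_neg, abs_of_nonneg b1, abs_of_nonneg b2]
  have := abs_nonneg (P i ω)
  have := abs_nonneg (Q i ω)
  nlinarith [mul_le_mul_of_nonneg_right a1 (abs_nonneg (P i ω)),
    mul_le_mul_of_nonneg_right a2 (abs_nonneg (Q i ω)), mul_nonneg c1 (abs_nonneg (Q i ω)),
    mul_nonneg c2 (abs_nonneg (P i ω))]

theorem giD_exp_le (h0 : t0 ∈ Set.Ioo (0:ℝ) 1) (ht : t ∈ Set.Ioo (t0 / 2) ((t0 + 1) / 2)) (i : ι)
    (ω : Ω) : |β * giD P Q t i ω| * Real.exp (β * giH P Q t i ω) ≤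
      |β| * giKap t0 * Real.exp ((|β| + 1) * (|P i ω| + |Q i ω|)) := by
  have h1 := giD_le (P := P) (Q := Q) h0 ht i ω
  have h2 := (le_abs_self _).trans
    (giH_le (P := P) (Q := Q) (β := β) (Set.Ioo_subset_Icc_self (gi_nbhd h0 ht)) i ω)
  set A := |P i ω| + |Q i ω|
  have hA : A ≤ Real.exp A := by linarith [Real.add_one_le_exp A]
  have hk := giKap_nonneg t0
  rw [abs_mul, show (|β| + 1) * A = A + |β| * A by ring, Real.exp_add]
  have e1 : |giD P Q t i ω| ≤ giKap t0 * Real.exp A :=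
    h1.trans (mul_le_mul_of_nonneg_left hA hk)
  have e2 := Real.exp_le_exp.2 h2
  calc |β| * |giD P Q t i ω| * Real.exp (β * giH P Q t i ω)
      ≤ |β| * (giKap t0 * Real.exp A) * Real.exp (|β| * A) := by gcongr
    _ = _ := by ring

theorem gi_logZ_deriv (hu : ∀ i, 0 ≤ u i) (hS : HasSum u S) (hSp : 0 < S)
    (h0 : t0 ∈ Set.Ioo (0:ℝ) 1) (ht : t ∈ Set.Ioo (t0 / 2) ((t0 + 1) / 2)) (ω : Ω)
    (hω : Summable fun i => u i * Real.exp (|β| * (|P i ω| + |Q i ω|)))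
    (hω1 : Summable fun i => u i * Real.exp ((|β| + 1) * (|P i ω| + |Q i ω|))) :
    HasDerivAt (fun t => Real.log (giZ u fun j => β * giH P Q t j ω))
      (∑' j, β * giD P Q t j ω * giw u (fun j => β * giH P Q t j ω) j) t := by
  have hsum : ∀ t ∈ Set.Icc (0:ℝ) 1, Summable fun j => u j * Real.exp (β * giH P Q t j ω) :=
    fun t ht => gi_summable_of_le hu (fun i => (le_abs_self _).trans (giH_le ht i ω)) hω
  have hI := Set.Ioo_subset_Icc_self (gi_nbhd h0 ht)
  have hd : HasDerivAt (fun t => giZ u fun j => β * giH P Q t j ω)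
      (∑' j, u j * (Real.exp (β * giH P Q t j ω) * (β * giD P Q t j ω))) t := by
    unfold giZ
    refine hasDerivAt_tsum_of_isPreconnected (t := Set.Ioo (t0 / 2) ((t0 + 1) / 2))
      (u := fun j => |β| * giKap t0 * (u j * Real.exp ((|β| + 1) * (|P j ω| + |Q j ω|))))
      (g := fun j t => u j * Real.exp (β * giH P Q t j ω))
      (g' := fun j t => u j * (Real.exp (β * giH P Q t j ω) * (β * giD P Q t j ω)))
      (hω1.mul_left _) isOpen_Ioo isPreconnected_Ioo (fun j t ht => ?_) (fun j t ht => ?_) ht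
      (hsum t hI) ht
    · exact (((giH_deriv (gi_nbhd h0 ht) j ω).const_mul β).exp).const_mul (u j)
    · have := giD_exp_le (P := P) (Q := Q) (β := β) h0 ht j ω
      rw [Real.norm_eq_abs, abs_mul, abs_of_nonneg (hu j), abs_mul, abs_of_pos (Real.exp_pos _)]
      have := mul_le_mul_of_nonneg_left this (hu j)
      linarith
  have hZ := giZ_pos hu (hsum t hI) (gi_exists_pos hu hS hSp)
  refine (hd.log hZ.ne').congr_deriv ?_
  rw [← tsum_div_const]
  refine tsum_congr fun j => ?_
  unfold giw
  ring

theorem gi_term_le (hu : ∀ i, 0 ≤ u i) (hS : HasSum u S) (hSp : 0 < S)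
    (h0 : t0 ∈ Set.Ioo (0:ℝ) 1) (ht : t ∈ Set.Ioo (t0 / 2) ((t0 + 1) / 2)) (ω : Ω)
    (hω1 : Summable fun i => u i * Real.exp ((|β| + 1) * (|P i ω| + |Q i ω|))) (j : ι) :
    |β * giD P Q t j ω * giw u (fun j => β * giH P Q t j ω) j| ≤
      |β| * giKap t0 * (S ^ 2)⁻¹ * giZ u (fun i => (|β| + 1) * (|P i ω| + |Q i ω|)) *
        (u j * Real.exp ((|β| + 1) * (|P j ω| + |Q j ω|))) := by
  have hI := Set.Ioo_subset_Icc_self (gi_nbhd h0 ht)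
  have h1 := giD_exp_le (P := P) (Q := Q) (β := β) h0 ht j ω
  have h2 : (giZ u fun j => β * giH P Q t j ω)⁻¹ ≤ _ := giZ_inv_le hu hS hSp
    (fun i => (giH_le (P := P) (Q := Q) (β := β) hI i ω).trans
      (mul_le_mul_of_nonneg_right (by linarith : |β| ≤ |β| + 1) (by positivity))) hω1
  rw [abs_mul, abs_of_nonneg (giw_nonneg hu j), giw, div_eq_mul_inv]
  have hZ0 : 0 ≤ (giZ u fun j => β * giH P Q t j ω)⁻¹ := inv_nonneg.2 (giZ_nonneg hu)
  have hk := giKap_nonneg t0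
  have huj := hu j
  calc |β * giD P Q t j ω| * (u j * Real.exp (β * giH P Q t j ω) * (giZ u fun j => β * giH P Q t j ω)⁻¹)
      = u j * (|β * giD P Q t j ω| * Real.exp (β * giH P Q t j ω)) *
        (giZ u fun j => β * giH P Q t j ω)⁻¹ := by ring
    _ ≤ u j * (|β| * giKap t0 * Real.exp ((|β| + 1) * (|P j ω| + |Q j ω|))) *
        ((S ^ 2)⁻¹ * giZ u fun i => (|β| + 1) * (|P i ω| + |Q i ω|)) := by
      gcongr
    _ = _ := by ring

theorem giD_meas (G : GiSys μ P Q p r K M) (t : ℝ) (i : ι) : Measurable (giD P Q t i) := by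
  have := G.mP i; have := G.mQ i
  unfold giD; fun_prop

theorem giw_meas (G : GiSys μ P Q p r K M) (hu : ∀ i, 0 ≤ u i) (t : ℝ) (i : ι) :
    Measurable fun ω => giw u (fun j => β * giH P Q t j ω) i :=
  giw_measurable u (fun j ω => β * giH P Q t j ω) hu (fun j => (giH_meas G t j).const_mul β) i

theorem gi_deriv1 (G : GiSys μ P Q p r K M) (hu : ∀ i, 0 ≤ u i) (hS : HasSum u S) (hSp : 0 < S)
    (h0 : t0 ∈ Set.Ioo (0:ℝ) 1) :
    HasDerivAt (giPsi μ P Q β u)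
      (∫ ω, ∑' j, β * giD P Q t0 j ω * giw u (fun j => β * giH P Q t0 j ω) j ∂μ) t0 ∧
    HasSum (fun j => ∫ ω, β * giD P Q t0 j ω * giw u (fun j => β * giH P Q t0 j ω) j ∂μ)
      (∫ ω, ∑' j, β * giD P Q t0 j ω * giw u (fun j => β * giH P Q t0 j ω) j ∂μ) := by
  obtain ⟨w1, -, -⟩ := gi_W G hu hS |β| (abs_nonneg β)
  obtain ⟨x1, -, -⟩ := gi_W G hu hS (|β| + 1) (by positivity)
  obtain ⟨y1, y2, -⟩ := gi_W G hu hS (2 * (|β| + 1)) (by positivity)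
  have hmem : t0 ∈ Set.Ioo (t0 / 2) ((t0 + 1) / 2) := ⟨by linarith [h0.1], by linarith [h0.2]⟩
  have hk := giKap_nonneg t0
  set W : Ω → ℝ := fun ω => giZ u (fun i => (|β| + 1) * (|P i ω| + |Q i ω|)) with hW
  have hWm : Measurable W := by
    simp only [hW, giZ]
    refine Measurable.tsum fun j => ?_
    have := G.mP j; have := G.mQ j; fun_prop
  set c := |β| * giKap t0 * (S ^ 2)⁻¹ with hc
  have hc0 : 0 ≤ c := by positivity
  have hW2 : ∀ᵐ ω ∂μ, W ω ^ 2 ≤ S * giZ u (fun i => 2 * (|β| + 1) * (|P i ω| + |Q i ω|)) := by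
    filter_upwards [x1, y1] with ω hx hy
    have := giZ_sq_le (A := fun i => (|β| + 1) * (|P i ω| + |Q i ω|)) hu hS hSp hx
      (by simpa only [mul_assoc] using hy)
    simpa only [mul_assoc] using this
  have hWi : Integrable (fun ω => c * W ω ^ 2) μ := by
    refine Integrable.const_mul ?_ c
    refine (y2.const_mul S).mono' (hWm.pow_const 2).aestronglyMeasurable ?_
    filter_upwards [hW2] with ω h
    rw [Real.norm_of_nonneg (sq_nonneg _)]; exact h
  have hFm : ∀ j, Measurable fun ω => β * giD P Q t0 j ω * giw u (fun j => β * giH P Q t0 j ω) j :=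
    fun j => ((giD_meas G t0 j).const_mul β).mul (giw_meas G hu t0 j)
  constructor
  · refine (hasDerivAt_integral_of_dominated_loc_of_deriv_le (μ := μ)
      (F := fun t ω => Real.log (giZ u fun j => β * giH P Q t j ω))
      (F' := fun t ω => ∑' j, β * giD P Q t j ω * giw u (fun j => β * giH P Q t j ω) j)
      (bound := fun ω => c * W ω ^ 2)
      (Ioo_mem_nhds hmem.1 hmem.2) (Filter.Eventually.of_forall fun t => (gi_logZ_meas G t).aestronglyMeasurable)
      (gi_logZ_int G hu hS hSp (Set.Ioo_subset_Icc_self h0)).1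
      (Measurable.tsum hFm).aestronglyMeasurable ?_ hWi ?_).2
    · filter_upwards [x1] with ω hx t ht
      have := tsum_of_norm_bounded
        (f := fun j => β * giD P Q t j ω * giw u (fun j => β * giH P Q t j ω) j)
        (hx.hasSum.mul_left (c * W ω))
        (fun j => gi_term_le hu hS hSp h0 ht ω hx j)
      refine this.trans (le_of_eq ?_)
      simp only [hW, giZ]; ring
    · filter_upwards [w1, x1] with ω hw hx t ht
      exact gi_logZ_deriv hu hS hSp h0 ht ω hw hx
  · refine hasSum_integral_of_dominated_convergence
      (fun j ω => c * W ω * (u j * Real.exp ((|β| + 1) * (|P j ω| + |Q j ω|))))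
      (fun j => (hFm j).aestronglyMeasurable) (fun j => ?_) ?_ ?_ ?_
    · filter_upwards [x1] with ω hx
      exact gi_term_le hu hS hSp h0 hmem ω hx j
    · filter_upwards [x1] with ω hx
      exact hx.mul_left _
    · refine hWi.congr (Filter.Eventually.of_forall fun ω => ?_)
      simp only [tsum_mul_left]
      simp only [hW, giZ]; ring
    · filter_upwards [x1] with ω hx
      exact (Summable.of_norm_bounded (hx.mul_left (c * W ω))
        (fun j => gi_term_le hu hS hSp h0 hmem ω hx j)).hasSum

/-- the (unnormalised) Gibbs average of the covariance difference -/
noncomputable def giAvg (P Q : ι → Ω → ℝ) (p r : ι → ι → ℝ) (β : ℝ) (u : ι → ℝ) (t : ℝ) (ω : Ω) : ℝ :=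
  ∑' i, (∑' j, (p i j - r i j) * giw u (fun j => β * giH P Q t j ω) j) *
    giw u (fun j => β * giH P Q t j ω) i

theorem giAvg_le (G : GiSys μ P Q p r K M) (hu : ∀ i, 0 ≤ u i) (hM : 0 ≤ M) (t : ℝ) (ω : Ω) :
    |giAvg P Q p r β u t ω| ≤ M :=
  giw_mul_tsum_le hu hM fun i => giw_mul_tsum_le hu hM (G.CM i)

theorem gi_deriv (G : GiSys μ P Q p r K M) (hM : 0 ≤ M) (hu : ∀ i, 0 ≤ u i) (hS : HasSum u S)
    (hSp : 0 < S) (h0 : t0 ∈ Set.Ioo (0:ℝ) 1) :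
    HasDerivAt (giPsi μ P Q β u) (-(β ^ 2 / 2) * ∫ ω, giAvg P Q p r β u t0 ω ∂μ) t0 := by
  obtain ⟨d1, d2⟩ := gi_deriv1 (β := β) G hu hS hSp h0
  refine d1.congr_deriv ?_
  have hm : ∀ i, Measurable fun ω =>
      (∑' j, (p i j - r i j) * giw u (fun j => β * giH P Q t0 j ω) j) *
        giw u (fun j => β * giH P Q t0 j ω) i := fun i =>
    (Measurable.tsum fun j => (giw_meas G hu t0 j).const_mul _).mul (giw_meas G hu t0 i)
  have hb : ∀ i ω, ‖(∑' j, (p i j - r i j) * giw u (fun j => β * giH P Q t0 j ω) j) *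
        giw u (fun j => β * giH P Q t0 j ω) i‖ ≤ M * giw u (fun j => β * giH P Q t0 j ω) i := by
    intro i ω
    rw [Real.norm_eq_abs, abs_mul, abs_of_nonneg (giw_nonneg hu i)]
    exact mul_le_mul_of_nonneg_right (giw_mul_tsum_le hu hM (G.CM i)) (giw_nonneg hu i)
  have s2 : HasSum (fun i => ∫ ω, (∑' j, (p i j - r i j) * giw u (fun j => β * giH P Q t0 j ω) j) *
        giw u (fun j => β * giH P Q t0 j ω) i ∂μ) (∫ ω, giAvg P Q p r β u t0 ω ∂μ) := by
    refine hasSum_integral_of_dominated_convergence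
      (fun i ω => M * giw u (fun j => β * giH P Q t0 j ω) i)
      (fun i => (hm i).aestronglyMeasurable) (fun i => Filter.Eventually.of_forall (hb i))
      (Filter.Eventually.of_forall fun ω => giw_summable.mul_left M) ?_
      (Filter.Eventually.of_forall fun ω =>
        (Summable.of_norm_bounded (giw_summable.mul_left M) fun i => hb i ω).hasSum)
    refine (integrable_const M).mono'
      (Measurable.tsum fun j => (giw_meas G hu t0 j).const_mul _).aestronglyMeasurable
      (Filter.Eventually.of_forall fun ω => ?_)
    rw [tsum_mul_left, Real.norm_of_nonneg (mul_nonneg hM (tsum_nonneg fun i => giw_nonneg hu i))]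
    exact mul_le_of_le_one_right hM giw_tsum_le
  refine d2.unique ?_
  suffices hT : ∀ i, ∫ ω, β * giD P Q t0 i ω * giw u (fun j => β * giH P Q t0 j ω) i ∂μ =
      -(β ^ 2 / 2) * ∫ ω, (∑' j, (p i j - r i j) * giw u (fun j => β * giH P Q t0 j ω) j) *
        giw u (fun j => β * giH P Q t0 j ω) i ∂μ by
    rw [funext hT]; exact s2.mul_left _
  intro i
  have p0 : 0 < Real.sqrt t0 := Real.sqrt_pos.2 h0.1
  have p1 : 0 < Real.sqrt (1 - t0) := Real.sqrt_pos.2 (by linarith [h0.2])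
  have hKp := G.Kpos
  have hmean : ∫ ω, giD P Q t0 i ω ∂μ = 0 := by
    have a1 : Integrable (P i) μ := (G.hG.hasGaussianLaw_eval (Sum.inl i)).integrable
    have a2 : Integrable (Q i) μ := (G.hG.hasGaussianLaw_eval (Sum.inr i)).integrable
    unfold giD
    rw [integral_add (a1.const_mul _) (a2.const_mul _), integral_const_mul, integral_const_mul,
      G.P0, G.Q0]
    simp
  have hib := gi_ibp μ (giD P Q t0 i) (giH P Q t0) (giD_meas G t0 i) (giH_meas G t0)
    (gi_gauss G _ _ _ _ i) hmean _ ?_ (gi_cov G _ _ _ _ i i) (fun j => (p i j - r i j) / 2)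
    (fun j => ?_) (M / 2) (fun j => ?_) i ?_ u hu (gi_exists_pos hu hS hSp) β
  · simp only [mul_assoc, integral_const_mul]
    rw [hib]
    have : ∀ ω, (∑' j, (p i j - r i j) / 2 * giw u (fun j => β * giH P Q t0 j ω) j) *
        giw u (fun j => β * giH P Q t0 j ω) i = 1 / 2 *
        ((∑' j, (p i j - r i j) * giw u (fun j => β * giH P Q t0 j ω) j) *
        giw u (fun j => β * giH P Q t0 j ω) i) := by
      intro ω
      rw [← mul_assoc, ← tsum_mul_left]
      congr 1
      exact tsum_congr fun j => by ring
    simp only [this, integral_const_mul]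
    ring
  · rw [G.pK, G.rK]; 
    have : (-(1 / (2 * Real.sqrt (1 - t0)))) * (-(1 / (2 * Real.sqrt (1 - t0)))) * K =
      (1 / (2 * Real.sqrt (1 - t0))) * (1 / (2 * Real.sqrt (1 - t0))) * K := by ring
    rw [this]; positivity
  · refine (gi_cov G _ _ _ _ i j).trans ?_
    field_simp
    ring
  · rw [abs_div, abs_two]
    exact div_le_div_of_nonneg_right (G.CM i j) two_pos.le
  · simp [G.pK, G.rK]

theorem gi_anti (G : GiSys μ P Q p r K M) (hM : 0 ≤ M) (hC : ∀ i j, r i j ≤ p i j)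
    (hu : ∀ i, 0 ≤ u i) (hS : HasSum u S) (hSp : 0 < S) :
    giPsi μ P Q β u 1 ≤ giPsi μ P Q β u 0 := by
  have : AntitoneOn (giPsi μ P Q β u) (Set.Icc 0 1) := by
    refine antitoneOn_of_deriv_nonpos (convex_Icc 0 1) (gi_cont G hu hS hSp) ?_ ?_
    · rw [interior_Icc]
      exact fun t ht => (gi_deriv G hM hu hS hSp ht).differentiableAt.differentiableWithinAt
    · rw [interior_Icc]
      intro t ht
      rw [(gi_deriv G hM hu hS hSp ht).deriv]
      have : 0 ≤ ∫ ω, giAvg P Q p r β u t ω ∂μ := integral_nonneg fun ω =>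
        tsum_nonneg fun i => mul_nonneg (tsum_nonneg fun j =>
          mul_nonneg (sub_nonneg.2 (hC i j)) (giw_nonneg hu j)) (giw_nonneg hu i)
      nlinarith [sq_nonneg β, mul_nonneg (sq_nonneg β) this]
  exact this (by simp) (by simp) zero_le_one

end


set_option linter.unusedSectionVars false
section
variable {ι Ω Ω' : Type} [Countable ι] [MeasurableSpace Ω] {μ : Measure Ω} [IsProbabilityMeasure μ]
  [MeasurableSpace Ω'] {ν : Measure Ω'} [IsProbabilityMeasure ν]
  {P Q : ι → Ω → ℝ} {p r : ι → ι → ℝ} {K M : ℝ} {U : Ω' → ι → ℝ} {S β t t0 : ℝ}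

theorem gi_joint_Z (G : GiSys μ P Q p r K M) (hU : ∀ i, Measurable fun ω' => U ω' i) (t : ℝ) :
    Measurable fun x : Ω' × Ω => giZ (U x.1) fun j => β * giH P Q t j x.2 := by
  unfold giZ
  refine Measurable.tsum fun j => ?_
  have h1 : Measurable fun x : Ω' × Ω => U x.1 j := (hU j).comp measurable_fst
  have h2 : Measurable fun x : Ω' × Ω => giH P Q t j x.2 := (giH_meas G t j).comp measurable_snd
  fun_prop

theorem gi_joint_w (G : GiSys μ P Q p r K M) (hU : ∀ i, Measurable fun ω' => U ω' i) (t : ℝ)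
    (j : ι) : Measurable fun x : Ω' × Ω => giw (U x.1) (fun j => β * giH P Q t j x.2) j := by
  unfold giw
  refine Measurable.div ?_ (gi_joint_Z G hU t)
  have h1 : Measurable fun x : Ω' × Ω => U x.1 j := (hU j).comp measurable_fst
  have h2 : Measurable fun x : Ω' × Ω => giH P Q t j x.2 := (giH_meas G t j).comp measurable_snd
  fun_prop

theorem giPsi_meas (G : GiSys μ P Q p r K M) (hU : ∀ i, Measurable fun ω' => U ω' i) (t : ℝ) :
    AEStronglyMeasurable (fun ω' => giPsi μ P Q β (U ω') t) ν := by
  unfold giPsi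
  exact (StronglyMeasurable.integral_prod_right (ν := μ)
    (f := fun ω' ω => Real.log (giZ (U ω') fun j => β * giH P Q t j ω))
    (Real.measurable_log.comp (gi_joint_Z G hU t)).stronglyMeasurable).aestronglyMeasurable

theorem giAvg_meas (G : GiSys μ P Q p r K M) (hU : ∀ i, Measurable fun ω' => U ω' i) (t : ℝ) :
    AEStronglyMeasurable (fun ω' => ∫ ω, giAvg P Q p r β (U ω') t ω ∂μ) ν := by
  refine (StronglyMeasurable.integral_prod_right (ν := μ)
    (f := fun ω' ω => giAvg P Q p r β (U ω') t ω)
    (Measurable.stronglyMeasurable ?_)).aestronglyMeasurable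
  unfold Function.uncurry giAvg
  exact Measurable.tsum fun i => (Measurable.tsum fun j => (gi_joint_w G hU t j).const_mul _).mul
    (gi_joint_w G hU t i)

theorem gi_outer_int (G : GiSys μ P Q p r K M) (hU : ∀ i, Measurable fun ω' => U ω' i)
    (hu : ∀ ω' i, 0 ≤ U ω' i) (hS : ∀ ω', HasSum (U ω') S)
    (hSp : 0 < S) (ht : t ∈ Set.Icc (0:ℝ) 1) :
    Integrable (fun ω' => giPsi μ P Q β (U ω') t) ν :=
  (integrable_const _).mono' (giPsi_meas G hU t)
    (Filter.Eventually.of_forall fun ω' => (gi_logZ_int G (hu ω') (hS ω') hSp ht).2)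

theorem gi_outer (G : GiSys μ P Q p r K M) (hM : 0 ≤ M) (hU : ∀ i, Measurable fun ω' => U ω' i)
    (hu : ∀ ω' i, 0 ≤ U ω' i) (hS : ∀ ω', HasSum (U ω') S)
    (hSp : 0 < S) (h0 : t0 ∈ Set.Ioo (0:ℝ) 1) :
    HasDerivAt (fun t => ∫ ω', giPsi μ P Q β (U ω') t ∂ν)
      (-(β ^ 2 / 2) * ∫ ω', ∫ ω, giAvg P Q p r β (U ω') t0 ω ∂μ ∂ν) t0 := by
  rw [← integral_const_mul]
  refine (hasDerivAt_integral_of_dominated_loc_of_deriv_le (μ := ν)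
    (F := fun t ω' => giPsi μ P Q β (U ω') t)
    (F' := fun t ω' => -(β ^ 2 / 2) * ∫ ω, giAvg P Q p r β (U ω') t ω ∂μ)
    (bound := fun _ => (β ^ 2 / 2) * M)
    (Ioo_mem_nhds h0.1 h0.2) (Filter.Eventually.of_forall fun t => giPsi_meas G hU t)
    (gi_outer_int G hU hu hS hSp (Set.Ioo_subset_Icc_self h0))
    ((giAvg_meas G hU t0).const_mul _) ?_ (integrable_const _) ?_).2
  · refine Filter.Eventually.of_forall fun ω' t _ => ?_
    rw [norm_mul, norm_neg, Real.norm_of_nonneg (by positivity)]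
    refine mul_le_mul_of_nonneg_left ?_ (by positivity)
    have := norm_integral_le_of_norm_le (μ := μ) (f := fun ω => giAvg P Q p r β (U ω') t ω)
      (integrable_const M)
      (Filter.Eventually.of_forall fun ω => giAvg_le G (hu ω') hM t ω)
    simpa using this
  · exact Filter.Eventually.of_forall fun ω' t ht => gi_deriv G hM (hu ω') (hS ω') hSp ht

theorem gi_outer_anti (G : GiSys μ P Q p r K M) (hM : 0 ≤ M) (hC : ∀ i j, r i j ≤ p i j)
    (hU : ∀ i, Measurable fun ω' => U ω' i)
    (hu : ∀ ω' i, 0 ≤ U ω' i) (hS : ∀ ω', HasSum (U ω') S) (hSp : 0 < S) :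
    ∫ ω', giPsi μ P Q β (U ω') 1 ∂ν ≤ ∫ ω', giPsi μ P Q β (U ω') 0 ∂ν :=
  integral_mono (gi_outer_int G hU hu hS hSp (by simp)) (gi_outer_int G hU hu hS hSp (by simp))
    fun ω' => gi_anti G hM hC (hu ω') (hS ω') hSp

end


theorem gi_gp {T Ω : Type} [MeasurableSpace Ω] (μ : Measure Ω) [IsProbabilityMeasure μ]
    (B : T → Ω → ℝ) (hB : ∀ s, Measurable (B s))
    (h : ∀ (m : ℕ) (τ : Fin m → T) (c : Fin m → ℝ), ∃ v : NNReal,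
      Measure.map (fun ω => ∑ k, c k * B (τ k) ω) μ = gaussianReal 0 v) :
    IsGaussianProcess B μ ∧ ∀ s, ∫ ω, B s ω ∂μ = 0 := by
  classical
  constructor
  · refine ⟨fun I => ⟨?_⟩⟩
    have hm : Measurable fun ω => I.restrict fun x => B x ω :=
      measurable_pi_lambda _ fun x => hB x
    refine isGaussian_of_map_eq_gaussianReal fun L => ?_
    obtain ⟨v, hv⟩ := h (Fintype.card I) (fun k => ((Fintype.equivFin I).symm k : T))
      (fun k => L (Pi.single ((Fintype.equivFin I).symm k) 1))
    refine ⟨0, v, ?_⟩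
    rw [Measure.map_map L.continuous.measurable hm, ← hv]
    congr 1
    ext ω
    rw [(Fintype.equivFin I).symm.sum_comp (fun x : I => L (Pi.single x 1) * B x ω)]
    simp only [Function.comp]
    conv_lhs => rw [← Finset.univ_sum_single (I.restrict fun x => B x ω)]
    rw [map_sum]
    refine Finset.sum_congr rfl fun x _ => ?_
    have : (Pi.single x (I.restrict (fun x => B x ω) x) : I → ℝ) =
        B x ω • (Pi.single x 1 : I → ℝ) := by
      rw [← Pi.single_smul]; simp
    rw [this, map_smul, smul_eq_mul, mul_comm]
  · intro s
    obtain ⟨v, hv⟩ := h 1 (fun _ => s) (fun _ => 1)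
    simp only [Finset.univ_unique, Finset.sum_const, Finset.card_singleton, one_smul, one_mul] at hv
    have := integral_map (μ := μ) (hB s).aemeasurable (f := fun x : ℝ => x)
      measurable_id.aestronglyMeasurable
    rw [← this]
    have e : Measure.map (B s) μ = gaussianReal 0 v := hv
    rw [e]
    exact integral_id_gaussianReal

theorem gi_lc {T T' Ω : Type} [MeasurableSpace Ω] {μ : Measure Ω}
    {X : T → Ω → ℝ} (hX : IsGaussianProcess X μ) (Y : T' → Ω → ℝ)
    (h : ∀ s, ∃ (n : ℕ) (a : Fin n → ℝ) (τ : Fin n → T), ∀ ω, Y s ω = ∑ k, a k * X (τ k) ω) :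
    IsGaussianProcess Y μ := by
  classical
  refine hX.of_isGaussianProcess fun s => ?_
  obtain ⟨n, a, τ, e⟩ := h s
  refine ⟨Finset.univ.image τ, ∑ k, a k • ContinuousLinearMap.proj ⟨τ k, by simp⟩, fun ω => ?_⟩
  simp [e]

theorem wedge_self (r : ℕ) (α : Fin r → ℕ) : wedge r α α = r := by simp [wedge]

theorem wedge_le (r : ℕ) (α γ : Fin r → ℕ) : wedge r α γ ≤ r := by
  unfold wedge
  exact (Finset.card_filter_le _ _).trans (by simp)

theorem spin_sq {N : ℕ} (σ : SpinConf N) (i : Fin N) :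
    ((σ i : ℤ) : ℝ) * ((σ i : ℤ) : ℝ) = 1 := by
  have := (σ i).2
  simp only [Finset.mem_insert, Finset.mem_singleton] at this
  rcases this with h | h <;> rw [h] <;> norm_num

theorem spin_abs {N : ℕ} (σ : SpinConf N) (i : Fin N) : |((σ i : ℤ) : ℝ)| = 1 := by
  have := (σ i).2
  simp only [Finset.mem_insert, Finset.mem_singleton] at this
  rcases this with h | h <;> rw [h] <;> norm_num

theorem skR_self {N : ℕ} (hN : 0 < N) (σ : SpinConf N) : skR N σ σ = 1 := by
  have : (N : ℝ) ≠ 0 := by positivity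
  simp [skR, spin_sq, this]

theorem skR_mul {N : ℕ} (hN : 0 < N) (σ σ' : SpinConf N) :
    ∑ i : Fin N, ((σ i : ℤ) : ℝ) * ((σ' i : ℤ) : ℝ) = N * skR N σ σ' := by
  have : (N : ℝ) ≠ 0 := by positivity
  unfold skR; field_simp

theorem skR_abs {N : ℕ} (hN : 0 < N) (σ σ' : SpinConf N) : |skR N σ σ'| ≤ 1 := by
  have hNp : (0 : ℝ) < N := by positivity
  have h := skR_mul hN σ σ'
  have h2 : |(N : ℝ) * skR N σ σ'| ≤ N := by
    rw [← h]
    refine (Finset.abs_sum_le_sum_abs _ _).trans ?_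
    simp [abs_mul, spin_abs]
  rw [abs_mul, abs_of_pos hNp] at h2
  exact le_of_mul_le_mul_left (by linarith) hNp

theorem q_mem {r : ℕ} {q : ℕ → ℝ} (hq0 : q 0 = 0) (hqr : q r = 1)
    (hqmono : ∀ k, k < r → q k < q (k + 1)) {k : ℕ} (hk : k ≤ r) : 0 ≤ q k ∧ q k ≤ 1 := by
  have h : ∀ a b, a ≤ b → b ≤ r → q a ≤ q b := by
    intro a b hab
    induction b, hab using Nat.le_induction with
    | base => intro _; exact le_rfl
    | succ n hn ih => intro hb; exact (ih (by omega)).trans (hqmono n (by omega)).le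
  exact ⟨hq0 ▸ h 0 k (by omega) hk, hqr ▸ h k r hk le_rfl⟩

def guP {Ω : Type} {N r : ℕ} (HN : SpinConf N → Ω → ℝ) (y : Fin N → (Fin r → ℕ) → Ω → ℝ)
    (x : (Fin r → ℕ) × SpinConf N) (ω : Ω) : ℝ := HN x.2 ω + ∑ i, y i x.1 ω

def guQ {Ω : Type} {N r : ℕ} (z : Fin N → (Fin r → ℕ) → Ω → ℝ)
    (x : (Fin r → ℕ) × SpinConf N) (ω : Ω) : ℝ := ∑ i, z i x.1 ω * ((x.2 i : ℤ) : ℝ)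

theorem guerra_sys {Ω : Type} [MeasurableSpace Ω] (μ : Measure Ω) [IsProbabilityMeasure μ]
    (N r : ℕ) (hN : 0 < N)
    (q : ℕ → ℝ) (hq0 : q 0 = 0) (hqr : q r = 1)
    (hqmono : ∀ k, k < r → q k < q (k + 1))
    (HN : SpinConf N → Ω → ℝ) (z y : Fin N → (Fin r → ℕ) → Ω → ℝ)
    (hHNmeas : ∀ σ, Measurable (HN σ))
    (hzmeas : ∀ i α, Measurable (z i α)) (hymeas : ∀ i α, Measurable (y i α))
    (hHNcov : ∀ σ1 σ2, ∫ ω, HN σ1 ω * HN σ2 ω ∂μ = N * skR N σ1 σ2 ^ 2)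
    (hzcov : ∀ i i' α α', ∫ ω, z i α ω * z i' α' ω ∂μ =
      if i = i' then 2 * q (wedge r α α') else 0)
    (hycov : ∀ i i' α α', ∫ ω, y i α ω * y i' α' ω ∂μ =
      if i = i' then q (wedge r α α') ^ 2 else 0)
    (hcross1 : ∀ σ i α, ∫ ω, HN σ ω * z i α ω ∂μ = 0)
    (hcross2 : ∀ σ i α, ∫ ω, HN σ ω * y i α ω ∂μ = 0)
    (hcross3 : ∀ i i' α α', ∫ ω, z i α ω * y i' α' ω ∂μ = 0)
    (hGauss : ∀ (m : ℕ) (ξ : Fin m → Ω → ℝ),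
      (∀ k, (∃ σ, ξ k = HN σ) ∨ (∃ i α, ξ k = z i α) ∨ (∃ i α, ξ k = y i α)) →
      ∀ c : Fin m → ℝ,
        Measure.map (fun ω => ∑ k, c k * ξ k ω) μ =
          gaussianReal 0 (∫ ω, (∑ k, c k * ξ k ω) ^ 2 ∂μ).toNNReal) :
    GiSys μ (guP HN y) (guQ z)
      (fun a b => N * (skR N a.2 b.2 ^ 2 + q (wedge r a.1 b.1) ^ 2))
      (fun a b => N * (2 * q (wedge r a.1 b.1) * skR N a.2 b.2)) (2 * N) (4 * N) := by
  have hNp : (0 : ℝ) < N := by positivity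
  set B : (SpinConf N ⊕ ((Fin N × (Fin r → ℕ)) ⊕ (Fin N × (Fin r → ℕ)))) → Ω → ℝ :=
    Sum.elim HN (Sum.elim (fun x => z x.1 x.2) (fun x => y x.1 x.2)) with hB
  have hBm : ∀ s, Measurable (B s) := by
    rintro (s | s | s)
    · exact hHNmeas s
    · exact hzmeas _ _
    · exact hymeas _ _
  obtain ⟨gB, mB⟩ := gi_gp μ B hBm fun m τ c => ⟨_, hGauss m (fun k => B (τ k)) (fun k => by
    rcases τ k with s | s | s
    · exact Or.inl ⟨s, rfl⟩
    · exact Or.inr (Or.inl ⟨_, _, rfl⟩)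
    · exact Or.inr (Or.inr ⟨_, _, rfl⟩)) c⟩
  have LH : ∀ σ, MemLp (HN σ) 2 μ := fun σ => (gB.hasGaussianLaw_eval (Sum.inl σ)).memLp_two
  have Lz : ∀ i α, MemLp (z i α) 2 μ := fun i α =>
    (gB.hasGaussianLaw_eval (Sum.inr (Sum.inl (i, α)))).memLp_two
  have Ly : ∀ i α, MemLp (y i α) 2 μ := fun i α =>
    (gB.hasGaussianLaw_eval (Sum.inr (Sum.inr (i, α)))).memLp_two
  have IH : ∀ σ, Integrable (HN σ) μ := fun σ => (LH σ).integrable one_le_two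
  have Iz : ∀ i α, Integrable (z i α) μ := fun i α => (Lz i α).integrable one_le_two
  have Iy : ∀ i α, Integrable (y i α) μ := fun i α => (Ly i α).integrable one_le_two
  have mH : ∀ σ, ∫ ω, HN σ ω ∂μ = 0 := fun σ => mB (Sum.inl σ)
  have mz : ∀ i α, ∫ ω, z i α ω ∂μ = 0 := fun i α => mB (Sum.inr (Sum.inl (i, α)))
  have my : ∀ i α, ∫ ω, y i α ω ∂μ = 0 := fun i α => mB (Sum.inr (Sum.inr (i, α)))
  refine ⟨fun a => ?_, fun a => ?_, ?_, fun a => ?_, fun a => ?_, fun a b => ?_, fun a b => ?_,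
    fun a b => ?_, fun a => ?_, fun a => ?_, by positivity, fun a b => ?_⟩
  · unfold guP; fun_prop
  · unfold guQ; fun_prop
  · refine gi_lc gB _ ?_
    rintro (a | a)
    · refine ⟨N + 1, fun _ => 1, Fin.cons (Sum.inl a.2) (fun i => Sum.inr (Sum.inr (i, a.1))),
        fun ω => ?_⟩
      simp [Fin.sum_univ_succ, guP, hB]
    · refine ⟨N, fun i => ((a.2 i : ℤ) : ℝ), fun i => Sum.inr (Sum.inl (i, a.1)), fun ω => ?_⟩
      simp [guQ, hB, mul_comm]
  · unfold guP
    rw [integral_add (IH _) (integrable_finsetSum _ fun i _ => Iy i a.1),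
      integral_finsetSum _ fun i _ => Iy i a.1]
    simp [mH, my]
  · unfold guQ
    rw [integral_finsetSum _ fun i _ => (Iz i a.1).mul_const _]
    simp [integral_mul_const, mz]
  · have e : ∀ ω, guP HN y a ω * guP HN y b ω = (HN a.2 ω * HN b.2 ω + ∑ i, HN a.2 ω * y i b.1 ω)
        + ((∑ i, HN b.2 ω * y i a.1 ω) + ∑ i, ∑ j, y i a.1 ω * y j b.1 ω) := by
      intro ω
      simp only [guP]
      rw [← Finset.mul_sum, ← Finset.mul_sum, ← Finset.sum_mul_sum]
      ring
    have i1 : Integrable (fun ω => HN a.2 ω * HN b.2 ω) μ := (LH _).integrable_mul (LH _)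
    have k2 : ∀ i, Integrable (fun ω => HN a.2 ω * y i b.1 ω) μ :=
      fun i => (LH _).integrable_mul (Ly _ _)
    have k3 : ∀ i, Integrable (fun ω => HN b.2 ω * y i a.1 ω) μ :=
      fun i => (LH _).integrable_mul (Ly _ _)
    have k4 : ∀ i j, Integrable (fun ω => y i a.1 ω * y j b.1 ω) μ :=
      fun i j => (Ly _ _).integrable_mul (Ly _ _)
    have i2 : Integrable (fun ω => ∑ i, HN a.2 ω * y i b.1 ω) μ :=
      integrable_finsetSum _ fun i _ => k2 i
    have i3 : Integrable (fun ω => ∑ i, HN b.2 ω * y i a.1 ω) μ :=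
      integrable_finsetSum _ fun i _ => k3 i
    have k5 : ∀ i, Integrable (fun ω => ∑ j, y i a.1 ω * y j b.1 ω) μ := fun i =>
      integrable_finsetSum _ fun j _ => k4 i j
    have i4 : Integrable (fun ω => ∑ i, ∑ j, y i a.1 ω * y j b.1 ω) μ :=
      integrable_finsetSum _ fun i _ => k5 i
    have j1 : Integrable (fun ω => HN a.2 ω * HN b.2 ω + ∑ i, HN a.2 ω * y i b.1 ω) μ := i1.add i2
    have j2 : Integrable (fun ω => (∑ i, HN b.2 ω * y i a.1 ω) +
      ∑ i, ∑ j, y i a.1 ω * y j b.1 ω) μ := i3.add i4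
    simp only [e]
    rw [integral_add j1 j2, integral_add i1 i2, integral_add i3 i4,
      integral_finsetSum _ (fun i _ => k2 i), integral_finsetSum _ (fun i _ => k3 i),
      integral_finsetSum _ (fun i _ => k5 i)]
    simp only [integral_finsetSum _ (fun j _ => k4 _ j), hHNcov, hcross2, hycov]
    simp
    ring
  · have e : ∀ ω, guQ z a ω * guQ z b ω =
        ∑ i, ∑ j, (((a.2 i : ℤ) : ℝ) * ((b.2 j : ℤ) : ℝ)) * (z i a.1 ω * z j b.1 ω) := by
      intro ω
      simp only [guQ]
      rw [Finset.sum_mul_sum]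
      exact Finset.sum_congr rfl fun i _ => Finset.sum_congr rfl fun j _ => by ring
    have k4 : ∀ i j, Integrable (fun ω => (((a.2 i : ℤ) : ℝ) * ((b.2 j : ℤ) : ℝ)) *
        (z i a.1 ω * z j b.1 ω)) μ :=
      fun i j => ((Lz _ _).integrable_mul (Lz _ _)).const_mul _
    have k5 : ∀ i, Integrable (fun ω => ∑ j, (((a.2 i : ℤ) : ℝ) * ((b.2 j : ℤ) : ℝ)) *
        (z i a.1 ω * z j b.1 ω)) μ := fun i =>
      integrable_finsetSum _ fun j _ => k4 i j
    simp only [e]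
    rw [integral_finsetSum _ (fun i _ => k5 i)]
    simp only [integral_finsetSum _ (fun j _ => k4 _ j), integral_const_mul, hzcov]
    simp only [mul_ite, mul_zero, Finset.sum_ite_eq, Finset.mem_univ, if_true]
    rw [← Finset.sum_mul, skR_mul hN]
    ring
  · have e : ∀ ω, guP HN y a ω * guQ z b ω =
        ∑ i, (((b.2 i : ℤ) : ℝ) * (HN a.2 ω * z i b.1 ω) +
          ∑ j, ((b.2 i : ℤ) : ℝ) * (z i b.1 ω * y j a.1 ω)) := by
      intro ω
      simp only [guP, guQ]
      rw [Finset.mul_sum]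
      refine Finset.sum_congr rfl fun i _ => ?_
      rw [← Finset.mul_sum, ← Finset.mul_sum]
      ring
    have k1 : ∀ i, Integrable (fun ω => ((b.2 i : ℤ) : ℝ) * (HN a.2 ω * z i b.1 ω)) μ :=
      fun i => ((LH _).integrable_mul (Lz _ _)).const_mul _
    have k4 : ∀ i j, Integrable (fun ω => ((b.2 i : ℤ) : ℝ) * (z i b.1 ω * y j a.1 ω)) μ :=
      fun i j => ((Lz _ _).integrable_mul (Ly _ _)).const_mul _
    have k5 : ∀ i, Integrable (fun ω => ∑ j, ((b.2 i : ℤ) : ℝ) * (z i b.1 ω * y j a.1 ω)) μ :=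
      fun i => integrable_finsetSum _ fun j _ => k4 i j
    have k6 : ∀ i, Integrable (fun ω => ((b.2 i : ℤ) : ℝ) * (HN a.2 ω * z i b.1 ω) +
      ∑ j, ((b.2 i : ℤ) : ℝ) * (z i b.1 ω * y j a.1 ω)) μ := fun i => (k1 i).add (k5 i)
    simp only [e]
    rw [integral_finsetSum _ (fun i _ => k6 i)]
    refine Finset.sum_eq_zero fun i _ => ?_
    rw [integral_add (k1 i) (k5 i), integral_finsetSum _ (fun j _ => k4 i j)]
    simp [integral_const_mul, hcross1, hcross3]
  · simp only [wedge_self, hqr, skR_self hN]; ring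
  · simp only [wedge_self, hqr, skR_self hN]; ring
  · obtain ⟨q1, q2⟩ := q_mem hq0 hqr hqmono (wedge_le r a.1 b.1)
    obtain ⟨s1, s2⟩ := abs_le.1 (skR_abs hN a.2 b.2)
    have : (N : ℝ) * (skR N a.2 b.2 ^ 2 + q (wedge r a.1 b.1) ^ 2) -
        N * (2 * q (wedge r a.1 b.1) * skR N a.2 b.2) =
        N * (skR N a.2 b.2 - q (wedge r a.1 b.1)) ^ 2 := by ring
    rw [this, abs_of_nonneg (by positivity), mul_comm (4 : ℝ)]
    refine mul_le_mul_of_nonneg_left ?_ hNp.le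
    nlinarith


theorem gu_tsum_prod {A B : Type} [Fintype B] (f : A × B → ℝ) (hf : ∀ x, 0 ≤ f x) :
    ∑' a, ∑ b, f (a, b) = ∑' x, f x := by
  by_cases hs : Summable f
  · rw [hs.tsum_prod]
    exact tsum_congr fun a => (tsum_fintype _).symm
  · rw [tsum_eq_zero_of_not_summable hs]
    refine tsum_eq_zero_of_not_summable fun h => hs ?_
    refine (summable_prod_of_nonneg hf).2 ⟨fun a => (hasSum_fintype _).summable, ?_⟩
    simpa only [tsum_fintype] using h

section
variable {Ω Ω' : Type} {N r : ℕ} {q : ℕ → ℝ}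
    {HN : SpinConf N → Ω → ℝ} {z y : Fin N → (Fin r → ℕ) → Ω → ℝ}
    {v : Ω' → (Fin r → ℕ) → ℝ} {β : ℝ}

theorem gu_H (t : ℝ) (σ : SpinConf N) (α : Fin r → ℕ) (ω : Ω) :
    guerraH N r HN z y t σ α ω = giH (guP HN y) (guQ z) t (α, σ) ω := by
  simp only [guerraH, giH, guP, guQ]; ring

theorem gu_Z (hv : ∀ ω' α, 0 ≤ v ω' α) (t : ℝ) (ω' : Ω') (ω : Ω) :
    guerraZ N r HN z y v β t ω' ω =
      giZ (fun x : (Fin r → ℕ) × SpinConf N => v ω' x.1)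
        (fun j => β * giH (guP HN y) (guQ z) t j ω) := by
  simp only [guerraZ, giZ, gu_H]
  exact gu_tsum_prod (fun x : (Fin r → ℕ) × SpinConf N => v ω' x.1 *
    Real.exp (β * giH (guP HN y) (guQ z) t x ω))
    fun x => mul_nonneg (hv _ _) (Real.exp_pos _).le

theorem gu_avg (hN : 0 < N) (hv : ∀ ω' α, 0 ≤ v ω' α) (hq : ∀ α γ, |q (wedge r α γ)| ≤ 1)
    (t : ℝ) (ω' : Ω') (ω : Ω) :
    ∑' α1 : Fin r → ℕ, ∑' α2 : Fin r → ℕ, ∑ σ1 : SpinConf N, ∑ σ2 : SpinConf N,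
      (skR N σ1 σ2 - q (wedge r α1 α2)) ^ 2 *
        (v ω' α1 * Real.exp (β * guerraH N r HN z y t σ1 α1 ω) /
          guerraZ N r HN z y v β t ω' ω) *
        (v ω' α2 * Real.exp (β * guerraH N r HN z y t σ2 α2 ω) /
          guerraZ N r HN z y v β t ω' ω) =
      (1 / N) * giAvg (guP HN y) (guQ z)
        (fun a b => N * (skR N a.2 b.2 ^ 2 + q (wedge r a.1 b.1) ^ 2))
        (fun a b => N * (2 * q (wedge r a.1 b.1) * skR N a.2 b.2)) β
        (fun x : (Fin r → ℕ) × SpinConf N => v ω' x.1) t ω := by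
  have hNp : (0 : ℝ) < N := by positivity
  set u : (Fin r → ℕ) × SpinConf N → ℝ := fun x => v ω' x.1 with hu
  have hu0 : ∀ x, 0 ≤ u x := fun x => hv _ _
  set w : (Fin r → ℕ) × SpinConf N → ℝ :=
    giw u (fun j => β * giH (guP HN y) (guQ z) t j ω) with hw
  have hw0 : ∀ x, 0 ≤ w x := fun x => giw_nonneg hu0 x
  have e1 : ∀ α σ, v ω' α * Real.exp (β * guerraH N r HN z y t σ α ω) /
      guerraZ N r HN z y v β t ω' ω = w (α, σ) := by
    intro α σ
    rw [gu_Z hv, gu_H]; rfl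
  simp only [e1]
  have hb : ∀ a b : (Fin r → ℕ) × SpinConf N,
      |(skR N a.2 b.2 - q (wedge r a.1 b.1)) ^ 2| ≤ 4 := by
    intro a b
    obtain ⟨q1, q2⟩ := abs_le.1 (hq a.1 b.1)
    obtain ⟨s1, s2⟩ := abs_le.1 (skR_abs hN a.2 b.2)
    rw [abs_of_nonneg (sq_nonneg _)]
    nlinarith
  have hsm : ∀ a : (Fin r → ℕ) × SpinConf N,
      Summable fun b => (skR N a.2 b.2 - q (wedge r a.1 b.1)) ^ 2 * w a * w b := by
    intro a
    have := (giw_mul_summable (h := fun j => β * giH (guP HN y) (guQ z) t j ω) hu0 (hb a)).mul_left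
      (w a)
    refine this.congr fun b => ?_
    simp only [hw]; ring
  have h1 : ∀ α1, ∑' α2 : Fin r → ℕ, ∑ σ1 : SpinConf N, ∑ σ2 : SpinConf N,
      (skR N σ1 σ2 - q (wedge r α1 α2)) ^ 2 * w (α1, σ1) * w (α2, σ2) =
      ∑ σ1, ∑' b : (Fin r → ℕ) × SpinConf N,
        (skR N σ1 b.2 - q (wedge r α1 b.1)) ^ 2 * w (α1, σ1) * w b := by
    intro α1
    rw [← Summable.tsum_finsetSum (fun σ1 _ => hsm (α1, σ1))]
    rw [← gu_tsum_prod (fun b : (Fin r → ℕ) × SpinConf N => ∑ σ1 : SpinConf N,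
        (skR N σ1 b.2 - q (wedge r α1 b.1)) ^ 2 * w (α1, σ1) * w b)
        (fun b => Finset.sum_nonneg fun σ1 _ =>
          mul_nonneg (mul_nonneg (sq_nonneg _) (hw0 _)) (hw0 _))]
    exact tsum_congr fun α2 => Finset.sum_comm
  simp only [h1]
  rw [gu_tsum_prod (fun a : (Fin r → ℕ) × SpinConf N => ∑' b : (Fin r → ℕ) × SpinConf N,
        (skR N a.2 b.2 - q (wedge r a.1 b.1)) ^ 2 * w a * w b)
        (fun a => tsum_nonneg fun b =>
          mul_nonneg (mul_nonneg (sq_nonneg _) (hw0 _)) (hw0 _))]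
  unfold giAvg
  rw [← tsum_mul_left]
  refine tsum_congr fun a => ?_
  rw [← tsum_mul_right, ← tsum_mul_left]
  refine tsum_congr fun b => ?_
  simp only [← hw]
  field_simp
  ring

theorem gu_u (v : (Fin r → ℕ) → ℝ) (hv : ∀ α, 0 ≤ v α) (h : HasSum v 1) :
    HasSum (fun x : (Fin r → ℕ) × SpinConf N => v x.1) (Fintype.card (SpinConf N) : ℝ) := by
  have hs : Summable (fun x : (Fin r → ℕ) × SpinConf N => v x.1) := by
    refine (summable_prod_of_nonneg fun x => hv _).2 ⟨fun a => (hasSum_fintype _).summable, ?_⟩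
    simp only [tsum_fintype, Finset.sum_const, nsmul_eq_mul]
    exact h.summable.mul_left _
  have := hs.hasSum
  rw [← gu_tsum_prod _ (fun x => hv _)] at this
  simp only [Finset.sum_const, nsmul_eq_mul, tsum_mul_left, h.tsum_eq, mul_one] at this
  simpa using this

end

/-- In the Guerra interpolation for the SK model,
`φ'(t) = −(β²/2) E⟨(R_{1,2} − q_{α¹∧α²})²⟩_t ≤ 0`, hence `φ(1) ≤ φ(0)`.  The randomness
consists of a centered jointly Gaussian family `(H_N(σ), z_i(α), y_i(α))` on `(Ω, ℙg)` with
`E H_N(σ¹)H_N(σ²) = N R_{1,2}²`, `E z_i(α)z_{i'}(α') = 2 q_{α∧α'} δ_{ii'}`,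
`E y_i(α)y_{i'}(α') = q_{α∧α'}² δ_{ii'}`, vanishing cross-covariances, and independent
random cascade weights `v_α ≥ 0`, `∑_α v_α = 1` on `(Ω', ℙv)`; the grid satisfies
`0 = q₀ < q₁ < … < q_r = 1`. -/
theorem guerra_interpolation_derivative
    {Ω Ω' : Type} [MeasureSpace Ω] [IsProbabilityMeasure (ℙ : Measure Ω)]
    [MeasurableSpace Ω'] (ℙv : Measure Ω') [IsProbabilityMeasure ℙv]
    (N r : ℕ) (hN : 0 < N) (hr : 1 ≤ r)
    (q : ℕ → ℝ) (hq0 : q 0 = 0) (hqr : q r = 1)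
    (hqmono : ∀ k, k < r → q k < q (k + 1))
    (β : ℝ)
    (HN : SpinConf N → Ω → ℝ) (z y : Fin N → (Fin r → ℕ) → Ω → ℝ)
    (hHNmeas : ∀ σ, Measurable (HN σ))
    (hzmeas : ∀ i α, Measurable (z i α)) (hymeas : ∀ i α, Measurable (y i α))
    (hHNcov : ∀ σ1 σ2, ∫ ω, HN σ1 ω * HN σ2 ω ∂ℙ = N * skR N σ1 σ2 ^ 2)
    (hzcov : ∀ i i' α α', ∫ ω, z i α ω * z i' α' ω ∂ℙ =
      if i = i' then 2 * q (wedge r α α') else 0)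
    (hycov : ∀ i i' α α', ∫ ω, y i α ω * y i' α' ω ∂ℙ =
      if i = i' then q (wedge r α α') ^ 2 else 0)
    (hcross1 : ∀ σ i α, ∫ ω, HN σ ω * z i α ω ∂ℙ = 0)
    (hcross2 : ∀ σ i α, ∫ ω, HN σ ω * y i α ω ∂ℙ = 0)
    (hcross3 : ∀ i i' α α', ∫ ω, z i α ω * y i' α' ω ∂ℙ = 0)
    (hGauss : ∀ (m : ℕ) (ξ : Fin m → Ω → ℝ),
      (∀ k, (∃ σ, ξ k = HN σ) ∨ (∃ i α, ξ k = z i α) ∨ (∃ i α, ξ k = y i α)) →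
      ∀ c : Fin m → ℝ,
        Measure.map (fun ω => ∑ k, c k * ξ k ω) ℙ =
          gaussianReal 0 (∫ ω, (∑ k, c k * ξ k ω) ^ 2 ∂ℙ).toNNReal)
    (v : Ω' → (Fin r → ℕ) → ℝ)
    (hvmeas : ∀ α, Measurable fun ω' => v ω' α)
    (hvpos : ∀ ω' α, 0 ≤ v ω' α) (hvsum : ∀ ω', HasSum (v ω') 1) :
    (∀ t ∈ Set.Ioo (0 : ℝ) 1,
      HasDerivAt (guerraPhi ℙ ℙv N r HN z y v β)
        (-(β ^ 2 / 2) * guerraGibbsAvg ℙ ℙv N r q HN z y v β t) t ∧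
      -(β ^ 2 / 2) * guerraGibbsAvg ℙ ℙv N r q HN z y v β t ≤ 0) ∧
    guerraPhi ℙ ℙv N r HN z y v β 1 ≤ guerraPhi ℙ ℙv N r HN z y v β 0 := by
  
  have hNp : (0 : ℝ) < N := by positivity
  have G := guerra_sys (ℙ : Measure Ω) N r hN q hq0 hqr hqmono HN z y hHNmeas hzmeas hymeas hHNcov
    hzcov hycov hcross1 hcross2 hcross3 hGauss
  have hq : ∀ α γ, |q (wedge r α γ)| ≤ 1 := fun α γ => by
    obtain ⟨q1, q2⟩ := q_mem hq0 hqr hqmono (wedge_le r α γ)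
    exact abs_le.2 ⟨by linarith, q2⟩
  have hSp : (0 : ℝ) < (Fintype.card (SpinConf N) : ℝ) := by
    have : Nonempty (SpinConf N) := ⟨fun _ => ⟨1, by simp⟩⟩
    exact_mod_cast Fintype.card_pos
  set U : Ω' → (Fin r → ℕ) × SpinConf N → ℝ := fun ω' x => v ω' x.1 with hU
  have hUm : ∀ x, Measurable fun ω' => U ω' x := fun x => hvmeas _
  have hU0 : ∀ ω' x, 0 ≤ U ω' x := fun ω' x => hvpos _ _
  have hUs : ∀ ω', HasSum (U ω') (Fintype.card (SpinConf N) : ℝ) :=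
    fun ω' => gu_u (v ω') (hvpos ω') (hvsum ω')
  have hphi : guerraPhi ℙ ℙv N r HN z y v β =
      fun t => (1 / (N : ℝ)) * ∫ ω', giPsi ℙ (guP HN y) (guQ z) β (U ω') t ∂ℙv := by
    ext t
    simp only [guerraPhi, giPsi, gu_Z hvpos, hU]
  have hM : (0 : ℝ) ≤ 4 * N := by positivity
  refine ⟨fun t ht => ⟨?_, ?_⟩, ?_⟩
  · rw [hphi]
    refine ((gi_outer (ν := ℙv) (β := β) G hM hUm hU0 hUs hSp ht).const_mul (1 / (N : ℝ))).congr_deriv ?_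
    simp only [guerraGibbsAvg, gu_avg hN hvpos hq, integral_const_mul, hU]
    ring
  · have : 0 ≤ guerraGibbsAvg ℙ ℙv N r q HN z y v β t := by
      have hZ : ∀ ω' ω, 0 ≤ guerraZ N r HN z y v β t ω' ω := fun ω' ω =>
        tsum_nonneg fun α => Finset.sum_nonneg fun σ _ =>
          mul_nonneg (hvpos _ _) (Real.exp_pos _).le
      have hW : ∀ ω' ω α σ, 0 ≤ v ω' α * Real.exp (β * guerraH N r HN z y t σ α ω) /
          guerraZ N r HN z y v β t ω' ω := fun ω' ω α σ =>
        div_nonneg (mul_nonneg (hvpos _ _) (Real.exp_pos _).le) (hZ _ _)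
      exact integral_nonneg fun ω' => integral_nonneg fun ω => tsum_nonneg fun α1 =>
        tsum_nonneg fun α2 => Finset.sum_nonneg fun σ1 _ => Finset.sum_nonneg fun σ2 _ =>
          mul_nonneg (mul_nonneg (sq_nonneg _) (hW _ _ _ _)) (hW _ _ _ _)
    nlinarith [mul_nonneg (sq_nonneg β) this]
  · rw [hphi]
    refine mul_le_mul_of_nonneg_left ?_ (by positivity)
    refine gi_outer_anti G hM (fun a b => ?_) hUm hU0 hUs hSp
    nlinarith [mul_nonneg hNp.le (sq_nonneg (skR N a.2 b.2 - q (wedge r a.1 b.1)))]
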